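/- Let r be a positive integer, X ⊆ ℝ^m and Y ⊆ ℝⁿ definable C^r submanifolds, f: X → Y a definable C^{r−1} map, and ε: X → ℝ a positive definable continuous function. Then there exists a definable C^r map f̃: X → Y such that ‖f(x) − f̃(x)‖ < ε(x) for all x ∈ X. -/

import Mathlib

open FirstOrder Set Topology

namespace Paper

variable (L : FirstOrder.Language) [L.Structure ℝ]

/-- A subset of `ℝⁿ` is definable in the structure (with parameters from `ℝ`). -/
def Def (n : ℕ) (s : Set (Fin n → ℝ)) : Prop :=
  Set.Definable (Set.univ : Set ℝ) L s

/-- A subset of `ℝ` is definable. -/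
def Def1 (s : Set ℝ) : Prop := Def L 1 {x | x 0 ∈ s}

/-- The structure expands the ordered field `(ℝ, <, +, ·, 0, 1)`:
the order and the field operations (and the constants) are definable. -/
def ExpandsOrderedField : Prop :=
  Def L 2 {x | x 0 < x 1} ∧ Def L 3 {x | x 0 + x 1 = x 2} ∧
  Def L 3 {x | x 0 * x 1 = x 2} ∧ Def L 1 {x | x 0 = 0} ∧ Def L 1 {x | x 0 = 1}

/-- Local o-minimality: every definable subset of `ℝ` is, near each point, a finite
union of points and open intervals. -/
def LocallyOMinimal : Prop :=
  ∀ X : Set ℝ, Def1 L X → ∀ a : ℝ,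
    ∃ b c : ℝ, b < a ∧ a < c ∧
      ∃ (P : Finset ℝ) (J : Finset (ℝ × ℝ)),
        X ∩ Set.Ioo b c = ↑P ∪ ⋃ p ∈ J, Set.Ioo p.1 p.2

/-- First component of a point of `ℝ^(m+n) = ℝ^m × ℝ^n`. -/
def fstFun {m n : ℕ} (z : Fin (m + n) → ℝ) : Fin m → ℝ := fun i => z (Fin.castAdd n i)

/-- Second component of a point of `ℝ^(m+n) = ℝ^m × ℝ^n`. -/
def sndFun {m n : ℕ} (z : Fin (m + n) → ℝ) : Fin n → ℝ := fun j => z (Fin.natAdd m j)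

/-- The map `f : X → ℝⁿ`, `X ⊆ ℝ^m`, is definable (its graph over `X` is definable). -/
def DefMapOn (m n : ℕ) (X : Set (Fin m → ℝ)) (f : (Fin m → ℝ) → (Fin n → ℝ)) : Prop :=
  Def L (m + n) {z | fstFun z ∈ X ∧ sndFun z = f (fstFun z)}

/-- The function `f : X → ℝ`, `X ⊆ ℝ^m`, is definable. -/
def DefFunOn (m : ℕ) (X : Set (Fin m → ℝ)) (f : (Fin m → ℝ) → ℝ) : Prop :=
  DefMapOn L m 1 X fun x _ => f x

/-- `f` is of class `C^r` on `X` in the sense that near every point of `X` it agrees on `X`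
with a `C^r` map defined on an open neighborhood in the ambient space. -/
def CrMapOn (r m n : ℕ) (X : Set (Fin m → ℝ)) (f : (Fin m → ℝ) → (Fin n → ℝ)) : Prop :=
  ∀ a ∈ X, ∃ (W : Set (Fin m → ℝ)) (g : (Fin m → ℝ) → (Fin n → ℝ)),
    a ∈ W ∧ IsOpen W ∧ ContDiffOn ℝ r g W ∧ Set.EqOn f g (X ∩ W)

/-- Real-valued version of `CrMapOn`. -/
def CrFunOn (r m : ℕ) (X : Set (Fin m → ℝ)) (f : (Fin m → ℝ) → ℝ) : Prop :=
  ∀ a ∈ X, ∃ (W : Set (Fin m → ℝ)) (g : (Fin m → ℝ) → ℝ),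
    a ∈ W ∧ IsOpen W ∧ ContDiffOn ℝ r g W ∧ Set.EqOn f g (X ∩ W)

/-- A definable `C^r` map `X → ℝⁿ`. -/
def DefCrMapOn (r m n : ℕ) (X : Set (Fin m → ℝ)) (f : (Fin m → ℝ) → (Fin n → ℝ)) : Prop :=
  DefMapOn L m n X f ∧ CrMapOn r m n X f

/-- A definable `C^r` function `X → ℝ`. -/
def DefCrFunOn (r m : ℕ) (X : Set (Fin m → ℝ)) (f : (Fin m → ℝ) → ℝ) : Prop :=
  DefFunOn L m X f ∧ CrFunOn r m X f

/-- A definable `C^r` submanifold of `ℝⁿ` of dimension `d`: around every point there is a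
definable `C^r` chart of `ℝⁿ` straightening `M` to the first `d` coordinates. -/
def IsDefCrSubmanifold (r n d : ℕ) (M : Set (Fin n → ℝ)) : Prop :=
  Def L n M ∧
  ∀ a ∈ M, ∃ (U V : Set (Fin n → ℝ)) (φ ψ : (Fin n → ℝ) → (Fin n → ℝ)),
    a ∈ U ∧ IsOpen U ∧ Def L n U ∧
    (0 : Fin n → ℝ) ∈ V ∧ IsOpen V ∧ Def L n V ∧
    DefMapOn L n n U φ ∧ DefMapOn L n n V ψ ∧
    ContDiffOn ℝ r φ U ∧ ContDiffOn ℝ r ψ V ∧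
    Set.BijOn φ U V ∧ Set.InvOn ψ φ U V ∧
    φ a = 0 ∧
    φ '' (M ∩ U) = {x ∈ V | ∀ i : Fin n, d ≤ (i : ℕ) → x i = 0}

/-- The Euclidean norm on `ℝⁿ`. -/
noncomputable def eunorm {n : ℕ} (x : Fin n → ℝ) : ℝ := Real.sqrt (∑ i, x i ^ 2)

/-- Projection of `ℝⁿ` onto the `d` coordinates selected by `σ`. -/
def coordProj {n : ℕ} (d : ℕ) (σ : Fin d → Fin n) (x : Fin n → ℝ) : Fin d → ℝ :=
  fun i => x (σ i)

/-- `X ⊆ ℝⁿ` has dimension `d`: `d` is the largest integer such that some coordinate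
projection of `X` onto `ℝ^d` has nonempty interior. -/
def HasDim {n : ℕ} (X : Set (Fin n → ℝ)) (d : ℕ) : Prop :=
  (∃ σ : Fin d → Fin n, Function.Injective σ ∧ (interior (coordProj d σ '' X)).Nonempty) ∧
  ∀ (e : ℕ) (σ : Fin e → Fin n), Function.Injective σ →
    (interior (coordProj e σ '' X)).Nonempty → e ≤ d

/-- A (bounded) open box in `ℝⁿ`. -/
def IsOpenBox {n : ℕ} (B : Set (Fin n → ℝ)) : Prop :=
  ∃ a b : Fin n → ℝ, (∀ i, a i < b i) ∧ B = Set.pi Set.univ fun i => Set.Ioo (a i) (b i)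

section Helpers

/-! ### Definable predicates and functions on finite products -/

/-- A space identified with a finite power of `ℝ`. -/
class Coord (E : Type) [TopologicalSpace E] where
  ι : Type
  fin : Finite ι
  eqv : E ≃ₜ (ι → ℝ)

instance : Coord ℝ := ⟨Unit, inferInstance, (Homeomorph.funUnique Unit ℝ).symm⟩

instance (α : Type) [Finite α] : Coord (α → ℝ) := ⟨α, inferInstance, Homeomorph.refl _⟩

instance (E F : Type) [TopologicalSpace E] [TopologicalSpace F] [Coord E] [Coord F] :
    Coord (E × F) :=
  ⟨Coord.ι E ⊕ Coord.ι F,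
    by
      have := Coord.fin (E := E)
      have := Coord.fin (E := F)
      infer_instance,
    (Homeomorph.prodCongr Coord.eqv Coord.eqv).trans Homeomorph.sumArrowHomeomorphProdArrow.symm⟩

/-- Definable predicates on a coordinate space. -/
@[fun_prop]
def DP {E : Type} [TopologicalSpace E] [Coord E] (P : E → Prop) : Prop :=
  (univ : Set ℝ).Definable L {x : Coord.ι E → ℝ | P (Coord.eqv.symm x)}

/-- Definable functions between coordinate spaces. -/
@[fun_prop]
def DF {E F : Type} [TopologicalSpace E] [Coord E] [TopologicalSpace F] [Coord F]
    (f : E → F) : Prop :=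
  DP L (fun p : E × F => f p.1 = p.2)

/-- Definable subsets of a coordinate space. -/
def DS {E : Type} [TopologicalSpace E] [Coord E] (s : Set E) : Prop := DP L (· ∈ s)

/-- O-minimal expansions of the ordered field of reals. -/
class OMin : Prop where
  field : ExpandsOrderedField L
  lom : LocallyOMinimal L

variable {L}

section Basic

variable {E F G : Type} [TopologicalSpace E] [Coord E] [TopologicalSpace F] [Coord F]
  [TopologicalSpace G] [Coord G]

theorem definable_eq_coord {α : Type} (a b : α) :
    (univ : Set ℝ).Definable L {x : α → ℝ | x a = x b} := by
  exists (Language.Term.var a).equal (Language.Term.var b)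

theorem definable_eq_const {α : Type} (a : α) (c : ℝ) :
    (univ : Set ℝ).Definable L {x : α → ℝ | x a = c} := by
  exists (Language.Term.var a).equal (L.con (⟨c, trivial⟩ : (univ : Set ℝ))).term

theorem DP.reindex {P : F → Prop} (r : Coord.ι F → Coord.ι E) (hP : DP L P) :
    DP L (fun x : E => P (Coord.eqv.symm (Coord.eqv x ∘ r))) := by
  have := Set.Definable.preimage_comp (L := L) r hP
  unfold DP
  convert this using 1
  ext x
  simp

theorem DP.congr {P Q : E → Prop} (hP : DP L P) (h : ∀ x, Q x ↔ P x) : DP L Q := by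
  have : Q = P := funext fun x => propext (h x)
  rwa [this]

@[fun_prop]
theorem DP.and {P Q : E → Prop} (hP : DP L P) (hQ : DP L Q) : DP L (fun x => P x ∧ Q x) :=
  Set.Definable.inter hP hQ

@[fun_prop]
theorem DP.or {P Q : E → Prop} (hP : DP L P) (hQ : DP L Q) : DP L (fun x => P x ∨ Q x) :=
  Set.Definable.union hP hQ

@[fun_prop]
theorem DP.not {P : E → Prop} (hP : DP L P) : DP L (fun x => ¬ P x) :=
  Set.Definable.compl hP

@[fun_prop]
theorem DP.iff {P Q : E → Prop} (hP : DP L P) (hQ : DP L Q) : DP L (fun x => P x ↔ Q x) := by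
  simp only [iff_iff_and_or_not_and_not]
  fun_prop

@[fun_prop]
theorem DP.const (p : Prop) : DP L (fun _ : E => p) := by
  by_cases hp : p
  · simp only [hp]
    exact Set.definable_univ
  · simp only [hp]
    exact Set.definable_empty

@[fun_prop]
theorem DP.ex {P : E → F → Prop} (hP : DP L (fun p : E × F => P p.1 p.2)) :
    DP L (fun x => ∃ y, P x y) := by
  have := Coord.fin (E := F)
  have h := Set.Definable.exists_of_finite (L := L) hP
  unfold DP
  convert h using 1
  ext x
  constructor
  · rintro ⟨y, hy⟩
    refine ⟨Coord.eqv y, ?_⟩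
    change P (Coord.eqv.symm x) (Coord.eqv.symm (Coord.eqv y))
    rwa [Homeomorph.symm_apply_apply]
  · rintro ⟨u, hu⟩
    exact ⟨Coord.eqv.symm u, hu⟩

@[fun_prop]
theorem DP.all {P : E → F → Prop} (hP : DP L (fun p : E × F => P p.1 p.2)) :
    DP L (fun x => ∀ y, P x y) := by
  have : DP L (fun x => ¬ ∃ y, ¬ P x y) := by fun_prop
  exact this.congr fun x => by simp

theorem DP.finite_all {κ : Type} [Finite κ] {P : κ → E → Prop} (hP : ∀ i, DP L (P i)) :
    DP L (fun x => ∀ i, P i x) := by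
  have := Set.definable_iInter_of_finite (L := L) (A := (univ : Set ℝ)) hP
  unfold DP
  convert this using 1
  ext x
  simp

theorem DP.finite_ex {κ : Type} [Finite κ] {P : κ → E → Prop} (hP : ∀ i, DP L (P i)) :
    DP L (fun x => ∃ i, P i x) := by
  have : DP L (fun x => ¬ ∀ i, ¬ P i x) := (DP.finite_all fun i => (hP i).not).not
  exact this.congr fun x => by simp

theorem DF.reindex (r : Coord.ι F → Coord.ι E) :
    DF L (fun x : E => (Coord.eqv.symm (Coord.eqv x ∘ r) : F)) := by
  have := Coord.fin (E := F)
  have h : ∀ i : Coord.ι F, DP L (fun p : E × F => Coord.eqv p.1 (r i) = Coord.eqv p.2 i) := by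
    intro i
    change Set.Definable _ L {x : Coord.ι E ⊕ Coord.ι F → ℝ |
      Coord.eqv (Coord.eqv.symm (fun j => x (Sum.inl j)) : E) (r i) =
        Coord.eqv (Coord.eqv.symm (fun j => x (Sum.inr j)) : F) i}
    simp only [Homeomorph.apply_symm_apply]
    exact definable_eq_coord _ _
  refine (DP.finite_all h).congr fun p => ?_
  rw [Homeomorph.symm_apply_eq, funext_iff]
  rfl

@[fun_prop]
theorem DP.comp {P : F → Prop} {f : E → F} (hP : DP L P) (hf : DF L f) :
    DP L (fun x => P (f x)) := by
  have h1 : DP L (fun p : E × F => P p.2) := by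
    have := DP.reindex (L := L) (E := E × F) (Sum.inr : Coord.ι F → Coord.ι E ⊕ Coord.ι F) hP
    refine this.congr fun p => ?_
    have : (Coord.eqv.symm (Coord.eqv p ∘ (Sum.inr : Coord.ι F → Coord.ι E ⊕ Coord.ι F)) : F)
        = p.2 := by
      rw [Homeomorph.symm_apply_eq]; rfl
    rw [this]
  have h2 : DP L (fun x => ∃ y, f x = y ∧ P y) := DP.ex (DP.and hf h1)
  exact h2.congr fun x => by simp

@[fun_prop]
theorem DF.fst : DF L (fun x : E × F => x.1) := by
  convert DF.reindex (L := L) (E := E × F) (F := E) Sum.inl using 1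
  ext x
  exact (Homeomorph.symm_apply_eq _).2 rfl |>.symm

@[fun_prop]
theorem DF.snd : DF L (fun x : E × F => x.2) := by
  convert DF.reindex (L := L) (E := E × F) (F := F) Sum.inr using 1
  ext x
  exact (Homeomorph.symm_apply_eq _).2 rfl |>.symm

@[fun_prop]
theorem DF.id : DF L (fun x : E => x) := by
  convert DF.reindex (L := L) (E := E) (F := E) _root_.id using 1
  ext x
  exact (Homeomorph.symm_apply_eq _).2 rfl |>.symm

@[fun_prop]
theorem DF.comp {f : F → G} {g : E → F} (hf : DF L f) (hg : DF L g) :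
    DF L (fun x => f (g x)) := by
  have e1 : DF L (fun p : (E × G) × F => (p.1.1, p.2)) := by
    convert DF.reindex (L := L) (E := (E × G) × F) (F := E × F)
      (Sum.map Sum.inl _root_.id) using 1
    ext x : 1
    refine ((Homeomorph.symm_apply_eq _).2 ?_).symm
    ext i
    rcases i with i | i <;> rfl
  have e2 : DF L (fun p : (E × G) × F => (p.2, p.1.2)) := by
    convert DF.reindex (L := L) (E := (E × G) × F) (F := F × G)
      (Sum.elim Sum.inr (fun i => Sum.inl (Sum.inr i))) using 1
    ext x : 1
    refine ((Homeomorph.symm_apply_eq _).2 ?_).symm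
    ext i
    rcases i with i | i <;> rfl
  have h1 := DP.comp hg e1
  have h2 := DP.comp hf e2
  have h3 : DP L (fun p : E × G => ∃ y, g p.1 = y ∧ f y = p.2) := DP.ex (h1.and h2)
  exact DP.congr h3 fun p => by simp

theorem DP.eq_diag : DP L (fun p : F × F => p.1 = p.2) := DF.id

@[fun_prop]
theorem DF.prodMk {f : E → F} {g : E → G} (hf : DF L f) (hg : DF L g) :
    DF L (fun x => (f x, g x)) := by
  have e1 : DF L (fun p : E × (F × G) => (p.1, p.2.1)) := by
    convert DF.reindex (L := L) (E := E × (F × G)) (F := E × F)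
      (Sum.map _root_.id Sum.inl) using 1
    ext x : 1
    refine ((Homeomorph.symm_apply_eq _).2 ?_).symm
    ext i
    rcases i with i | i <;> rfl
  have e2 : DF L (fun p : E × (F × G) => (p.1, p.2.2)) := by
    convert DF.reindex (L := L) (E := E × (F × G)) (F := E × G)
      (Sum.map _root_.id Sum.inr) using 1
    ext x : 1
    refine ((Homeomorph.symm_apply_eq _).2 ?_).symm
    ext i
    rcases i with i | i <;> rfl
  refine DP.congr ((DP.comp hf e1).and (DP.comp hg e2)) fun p => ?_
  simp [Prod.ext_iff]

@[fun_prop]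
theorem DP.eq {f g : E → F} (hf : DF L f) (hg : DF L g) : DP L (fun x => f x = g x) :=
  DP.comp DP.eq_diag (hf.prodMk hg)

@[fun_prop]
theorem DP.mem {s : Set F} {f : E → F} (hs : DS L s) (hf : DF L f) : DP L (fun x => f x ∈ s) :=
  DP.comp hs hf

@[fun_prop]
theorem DF.const (c : F) : DF L (fun _ : E => c) := by
  have := Coord.fin (E := F)
  have h : ∀ i : Coord.ι F, DP L (fun p : F => Coord.eqv p i = Coord.eqv c i) := by
    intro i
    have := definable_eq_const (L := L) i (Coord.eqv c i)
    unfold DP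
    convert this using 1
    ext x
    simp
  have h1 : DP L (fun p : F => p = c) := by
    refine (DP.finite_all h).congr fun p => ?_
    rw [← funext_iff]
    simp
  exact (DP.comp h1 (f := fun p : E × F => p.2) (by fun_prop)).congr fun p => by
    exact eq_comm

@[fun_prop]
theorem DF.apply {α : Type} [Finite α] (i : α) : DF L (fun x : α → ℝ => x i) := by
  convert DF.reindex (L := L) (E := α → ℝ) (F := ℝ) (fun _ => i) using 1
  ext x
  exact (Homeomorph.symm_apply_eq _).2 rfl |>.symm

@[fun_prop]
theorem DF.pi {α : Type} [Finite α] {f : E → α → ℝ} (h : ∀ i, DF L (fun x => f x i)) :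
    DF L f := by
  have h1 : ∀ i, DP L (fun p : E × (α → ℝ) => f p.1 i = p.2 i) := by
    intro i
    have := h i
    have h2 : DF L (fun p : E × (α → ℝ) => f p.1 i) := DF.comp this DF.fst
    fun_prop
  refine DP.congr (DP.finite_all h1) fun p => ?_
  exact funext_iff

open Classical in
@[fun_prop]
theorem DF.ite {P : E → Prop} {f g : E → F} (hP : DP L P) (hf : DF L f) (hg : DF L g) :
    DF L (fun x => if P x then f x else g x) := by
  have h1 : DP L (fun p : E × F => P p.1) := DP.comp hP DF.fst
  have : DP L (fun p : E × F => (P p.1 ∧ f p.1 = p.2) ∨ (¬ P p.1 ∧ g p.1 = p.2)) :=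
    (h1.and (by fun_prop)).or (h1.not.and (by fun_prop))
  refine DP.congr this fun p => ?_
  by_cases h : P p.1 <;> simp [h]

theorem DP.exists_unique {P : E → F → Prop} (hP : DP L (fun p : E × F => P p.1 p.2)) :
    DP L (fun x => ∃! y, P x y) := by
  unfold ExistsUnique
  simp only [imp_iff_not_or]
  fun_prop

/-- The unique element satisfying a predicate, or `0`. -/
noncomputable def the {F : Type} [Zero F] (P : F → Prop) : F :=
  open Classical in if h : ∃! y, P y then h.choose else 0

theorem the_eq {F : Type} [Zero F] {P : F → Prop} {y : F} (hy : P y) (hu : ∀ z, P z → z = y) :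
    the P = y := by
  have h : ∃! y, P y := ⟨y, hy, hu⟩
  rw [the, dif_pos h]
  exact hu _ h.choose_spec.1

theorem DF.the [Zero F] {P : E → F → Prop} (hP : DP L (fun p : E × F => P p.1 p.2)) :
    DF L (fun x => the (P x)) := by
  have h1 := DP.exists_unique hP
  have h2 : DP L (fun p : E × F => ∃! y, P p.1 y) :=
    DP.comp (P := fun x => ∃! y, P x y) h1 DF.fst
  have h3 : DP L (fun p : E × F => ((∃! y, P p.1 y) ∧ P p.1 p.2) ∨
      (¬ (∃! y, P p.1 y) ∧ p.2 = 0)) := (h2.and hP).or (h2.not.and (by fun_prop))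
  refine DP.congr h3 fun p => ?_
  by_cases h : ∃! y, P p.1 y
  · obtain ⟨y, hy, hu⟩ := h
    change Paper.the (P p.1) = p.2 ↔ _
    rw [the_eq hy hu]
    have h : ∃! y, P p.1 y := ⟨y, hy, hu⟩
    simp only [h, true_and, not_true, false_and, or_false]
    exact ⟨fun h => h ▸ hy, fun h => (hu _ h).symm⟩
  · change Paper.the (P p.1) = p.2 ↔ _
    rw [Paper.the, dif_neg h]
    simp [h, eq_comm]

variable [OMin L]

theorem DP.lt_diag : DP L (fun p : ℝ × ℝ => p.1 < p.2) := by
  have h : DP L (fun x : Fin 2 → ℝ => x 0 < x 1) := (OMin.field (L := L)).1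
  have e : DF L (fun p : ℝ × ℝ => (![p.1, p.2] : Fin 2 → ℝ)) := by
    refine DF.pi fun i => ?_
    fin_cases i
    · exact DF.fst
    · exact DF.snd
  exact (DP.comp h e).congr fun p => by simp

theorem DF.add_diag : DF L (fun p : ℝ × ℝ => p.1 + p.2) := by
  have h : DP L (fun x : Fin 3 → ℝ => x 0 + x 1 = x 2) := (OMin.field (L := L)).2.1
  have e : DF L (fun p : (ℝ × ℝ) × ℝ => (![p.1.1, p.1.2, p.2] : Fin 3 → ℝ)) := by
    refine DF.pi fun i => ?_
    fin_cases i
    · change DF L (fun p : (ℝ × ℝ) × ℝ => p.1.1)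
      fun_prop
    · change DF L (fun p : (ℝ × ℝ) × ℝ => p.1.2)
      fun_prop
    · exact DF.snd
  exact (DP.comp h e).congr fun p => by simp

theorem DF.mul_diag : DF L (fun p : ℝ × ℝ => p.1 * p.2) := by
  have h : DP L (fun x : Fin 3 → ℝ => x 0 * x 1 = x 2) := (OMin.field (L := L)).2.2.1
  have e : DF L (fun p : (ℝ × ℝ) × ℝ => (![p.1.1, p.1.2, p.2] : Fin 3 → ℝ)) := by
    refine DF.pi fun i => ?_
    fin_cases i
    · change DF L (fun p : (ℝ × ℝ) × ℝ => p.1.1)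
      fun_prop
    · change DF L (fun p : (ℝ × ℝ) × ℝ => p.1.2)
      fun_prop
    · exact DF.snd
  exact (DP.comp h e).congr fun p => by simp

variable {f g : E → ℝ}

@[fun_prop]
theorem DP.lt (hf : DF L f) (hg : DF L g) : DP L (fun x => f x < g x) :=
  DP.comp DP.lt_diag (hf.prodMk hg)

@[fun_prop]
theorem DP.le (hf : DF L f) (hg : DF L g) : DP L (fun x => f x ≤ g x) := by
  simp only [← not_lt]
  fun_prop

@[fun_prop]
theorem DF.add (hf : DF L f) (hg : DF L g) : DF L (fun x => f x + g x) :=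
  DF.comp DF.add_diag (hf.prodMk hg)

@[fun_prop]
theorem DF.mul (hf : DF L f) (hg : DF L g) : DF L (fun x => f x * g x) :=
  DF.comp DF.mul_diag (hf.prodMk hg)

@[fun_prop]
theorem DF.neg (hf : DF L f) : DF L (fun x => -f x) := by
  have : DF L (fun x => (-1 : ℝ) * f x) := by fun_prop
  simpa using this

@[fun_prop]
theorem DF.sub (hf : DF L f) (hg : DF L g) : DF L (fun x => f x - g x) := by
  simp only [sub_eq_add_neg]
  fun_prop

@[fun_prop]
theorem DF.inv (hf : DF L f) : DF L (fun x => (f x)⁻¹) := by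
  have : DP L (fun p : E × ℝ => (f p.1 = 0 ∧ p.2 = 0) ∨ f p.1 * p.2 = 1) := by fun_prop
  refine DP.congr this fun p => ?_
  by_cases h : f p.1 = 0
  · simp [h, eq_comm]
  · simp only [h, false_and, false_or]
    constructor
    · rintro h1
      rw [← h1, mul_inv_cancel₀ h]
    · intro h1
      exact inv_eq_of_mul_eq_one_right h1

@[fun_prop]
theorem DF.div (hf : DF L f) (hg : DF L g) : DF L (fun x => f x / g x) := by
  simp only [div_eq_mul_inv]
  fun_prop

@[fun_prop]
theorem DF.pow (hf : DF L f) (n : ℕ) : DF L (fun x => f x ^ n) := by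
  induction n with
  | zero => simp only [pow_zero]; fun_prop
  | succ n ih => simp only [pow_succ]; fun_prop

@[fun_prop]
theorem DF.sum {κ : Type} {s : Finset κ} {f : κ → E → ℝ} (hf : ∀ i ∈ s, DF L (f i)) :
    DF L (fun x => ∑ i ∈ s, f i x) := by
  classical
  induction s using Finset.induction_on with
  | empty => simp only [Finset.sum_empty]; fun_prop
  | insert a s ha ih =>
    simp only [Finset.sum_insert ha]
    exact (hf a (by simp)).add (ih fun i hi => hf i (by simp [hi]))

@[fun_prop]
theorem DF.max (hf : DF L f) (hg : DF L g) : DF L (fun x => Max.max (f x) (g x)) := by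
  classical
  have : DF L (fun x => if f x ≤ g x then g x else f x) := by fun_prop
  convert this using 2
  split_ifs with h
  · exact max_eq_right h
  · exact max_eq_left (not_le.1 h).le

@[fun_prop]
theorem DF.min (hf : DF L f) (hg : DF L g) : DF L (fun x => Min.min (f x) (g x)) := by
  classical
  have : DF L (fun x => if f x ≤ g x then f x else g x) := by fun_prop
  convert this using 2
  split_ifs with h
  · exact min_eq_left h
  · exact min_eq_right (not_le.1 h).le

theorem DP.dist_lt {α : Type} [Fintype α] {f g : E → α → ℝ} {ρ : E → ℝ}
    (hf : DF L f) (hg : DF L g) (hρ : DF L ρ) : DP L (fun x => dist (f x) (g x) < ρ x) := by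
  have h : ∀ i, DP L (fun x => f x i - g x i < ρ x ∧ g x i - f x i < ρ x) := by
    intro i
    fun_prop
  have h2 : DP L (fun x => 0 < ρ x) := by fun_prop
  refine DP.congr (h2.and (DP.finite_all h)) fun x => ?_
  constructor
  · intro hx
    have h0 : 0 < ρ x := dist_nonneg.trans_lt hx
    refine ⟨h0, fun i => ?_⟩
    have := (dist_pi_lt_iff h0).1 hx i
    rw [Real.dist_eq, abs_lt] at this
    exact ⟨by linarith, by linarith⟩
  · rintro ⟨h0, hx⟩
    rw [dist_pi_lt_iff h0]
    intro i
    rw [Real.dist_eq, abs_lt]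
    exact ⟨by linarith [hx i], by linarith [hx i]⟩

@[fun_prop]
theorem DF.dist {α : Type} [Fintype α] {f g : E → α → ℝ} (hf : DF L f) (hg : DF L g) :
    DF L (fun x => dist (f x) (g x)) := by
  have h : DP L (fun q : (E × ℝ) × ℝ => Dist.dist (f q.1.1) (g q.1.1) < q.2 ↔ q.1.2 < q.2) :=
    DP.iff (DP.dist_lt (by fun_prop) (by fun_prop) (by fun_prop)) (by fun_prop)
  refine DP.congr (DP.all (P := fun (p : E × ℝ) c => Dist.dist (f p.1) (g p.1) < c ↔ p.2 < c) h)
    fun p => ?_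
  exact ⟨fun h c => by simp only [← h], fun h => eq_of_forall_gt_iff h⟩

end Basic

/-! ### Local o-minimality and Baire category -/

section Generic

/-- A predicate is eventually true or eventually false along a filter. -/
def Decided {E : Type} (l : Filter E) (P : E → Prop) : Prop :=
  (∀ᶠ x in l, P x) ∨ ∀ᶠ x in l, ¬ P x

theorem Decided.or {E : Type} {l : Filter E} {P Q : E → Prop} (hP : Decided l P)
    (hQ : Decided l Q) : Decided l (fun x => P x ∨ Q x) := by
  rcases hP with hP | hP
  · exact Or.inl (hP.mono fun x hx => Or.inl hx)
  rcases hQ with hQ | hQ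
  · exact Or.inl (hQ.mono fun x hx => Or.inr hx)
  · exact Or.inr ((hP.and hQ).mono fun x hx => by tauto)

theorem Decided.not {E : Type} {l : Filter E} {P : E → Prop} (hP : Decided l P) :
    Decided l (fun x => ¬ P x) := by
  rcases hP with hP | hP
  · exact Or.inr (hP.mono fun x hx => by tauto)
  · exact Or.inl hP

theorem Decided.congr {E : Type} {l : Filter E} {P Q : E → Prop} (hP : Decided l P)
    (h : ∀ᶠ x in l, P x ↔ Q x) : Decided l Q := by
  rcases hP with hP | hP
  · exact Or.inl ((hP.and h).mono fun x hx => hx.2.1 hx.1)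
  · exact Or.inr ((hP.and h).mono fun x hx hx2 => hx.1 (hx.2.2 hx2))

theorem Decided.exists_mem {E κ : Type} {l : Filter E} (s : Finset κ) {P : κ → E → Prop}
    (hP : ∀ i, Decided l (P i)) : Decided l (fun x => ∃ i ∈ s, P i x) := by
  classical
  induction s using Finset.induction_on with
  | empty => exact Or.inr (by simp)
  | insert a s _ ih =>
    exact ((hP a).or ih).congr (Filter.Eventually.of_forall fun x => by simp)

theorem decided_of_le_nhds [OMin L] {P : ℝ → Prop} (hP : DP L P) {l : Filter ℝ} {a : ℝ}
    (hl : l ≤ 𝓝 a) (h1 : ∀ p, Decided l (· < p)) (h2 : ∀ p, Decided l (p < ·)) :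
    Decided l P := by
  have hd : Def1 L {x | P x} := by
    have : DP L (fun x : Fin 1 → ℝ => P (x 0)) := by fun_prop
    exact this
  obtain ⟨b, c, hb, hc, F, J, h⟩ := OMin.lom (L := L) _ hd a
  have h3 : ∀ p, Decided l (· = p) := fun p =>
    ((h1 p).or (h2 p)).not.congr (Filter.Eventually.of_forall fun x => by
      simp [le_antisymm_iff, and_comm])
  have h4 : ∀ p : ℝ × ℝ, Decided l (fun x => p.1 < x ∧ x < p.2) := fun p =>
    ((h2 p.1).not.or (h1 p.2).not).not.congr (Filter.Eventually.of_forall fun x => by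
      simp)
  refine ((Decided.exists_mem F h3).or (Decided.exists_mem J h4)).congr ?_
  filter_upwards [hl (Ioo_mem_nhds hb hc)] with x hx
  have := Set.ext_iff.1 h x
  simp only [mem_inter_iff, mem_ofPred_eq, hx, and_true, mem_union, Finset.mem_coe, mem_iUnion,
    mem_Ioo, exists_prop] at this
  rw [this]
  simp

theorem decided_right [OMin L] {P : ℝ → Prop} (hP : DP L P) (a : ℝ) : Decided (𝓝[>] a) P := by
  refine decided_of_le_nhds hP nhdsWithin_le_nhds (fun p => ?_) (fun p => ?_)
  · rcases lt_or_ge a p with h | h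
    · exact Or.inl (nhdsWithin_le_nhds (Iio_mem_nhds h))
    · exact Or.inr (Filter.mem_of_superset self_mem_nhdsWithin fun x hx =>
        not_lt.2 (h.trans (le_of_lt hx)))
  · rcases lt_or_ge a p with h | h
    · exact Or.inr (Filter.mem_of_superset (nhdsWithin_le_nhds (Iio_mem_nhds h)) fun x hx =>
        not_lt.2 (le_of_lt hx))
    · exact Or.inl (Filter.mem_of_superset self_mem_nhdsWithin fun x hx => h.trans_lt hx)

theorem decided_left [OMin L] {P : ℝ → Prop} (hP : DP L P) (a : ℝ) : Decided (𝓝[<] a) P := by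
  refine decided_of_le_nhds hP nhdsWithin_le_nhds (fun p => ?_) (fun p => ?_)
  · rcases lt_or_ge p a with h | h
    · exact Or.inr (Filter.mem_of_superset (nhdsWithin_le_nhds (Ioi_mem_nhds h)) fun x hx =>
        not_lt.2 (le_of_lt hx))
    · exact Or.inl (Filter.mem_of_superset self_mem_nhdsWithin fun x hx =>
        lt_of_lt_of_le hx h)
  · rcases lt_or_ge p a with h | h
    · exact Or.inl (nhdsWithin_le_nhds (Ioi_mem_nhds h))
    · exact Or.inr (Filter.mem_of_superset self_mem_nhdsWithin fun x hx =>
        not_lt.2 ((le_of_lt hx).trans h))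

variable (L) in
/-- Every definable predicate is constant on some nonempty open subset of each nonempty
open set. -/
def LocallyDecided (E : Type) [TopologicalSpace E] [Coord E] : Prop :=
  ∀ P : E → Prop, DP L P → ∀ U : Set E, IsOpen U → U.Nonempty →
    ∃ V ⊆ U, IsOpen V ∧ V.Nonempty ∧ ((∀ x ∈ V, P x) ∨ ∀ x ∈ V, ¬ P x)

theorem locallyDecided_real [OMin L] : LocallyDecided L ℝ := by
  intro P hP U hU ⟨a, ha⟩
  have h1 : ∀ᶠ x in 𝓝[>] a, x ∈ U := nhdsWithin_le_nhds (hU.mem_nhds ha)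
  rcases decided_right hP a with h | h
  · obtain ⟨b, hb, hs⟩ := mem_nhdsGT_iff_exists_Ioo_subset.1 (h.and h1)
    exact ⟨Ioo a b, fun x hx => (hs hx).2, isOpen_Ioo, nonempty_Ioo.2 hb,
      Or.inl fun x hx => (hs hx).1⟩
  · obtain ⟨b, hb, hs⟩ := mem_nhdsGT_iff_exists_Ioo_subset.1 (h.and h1)
    exact ⟨Ioo a b, fun x hx => (hs hx).2, isOpen_Ioo, nonempty_Ioo.2 hb,
      Or.inr fun x hx => (hs hx).1⟩

variable {E F : Type} [TopologicalSpace E] [Coord E] [TopologicalSpace F] [Coord F]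

theorem LocallyDecided.baire [BaireSpace E] (h : LocallyDecided L E) {κ : Type} [Countable κ]
    {P : κ → E → Prop} (hP : ∀ k, DP L (P k)) {U : Set E} (hU : IsOpen U) (hne : U.Nonempty)
    (hcov : ∀ x ∈ U, ∃ k, P k x) :
    ∃ k, ∃ V ⊆ U, IsOpen V ∧ V.Nonempty ∧ ∀ x ∈ V, P k x := by
  let f : Option κ → Set E := fun o => o.elim Uᶜ (fun k => closure {x | P k x})
  have hd : Dense (⋃ o, interior (f o)) := by
    refine dense_iUnion_interior_of_closed ?_ ?_
    · rintro (_ | k)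
      · exact hU.isClosed_compl
      · exact isClosed_closure
    · refine eq_univ_of_forall fun x => mem_iUnion.2 ?_
      by_cases hx : x ∈ U
      · obtain ⟨k, hk⟩ := hcov x hx
        exact ⟨some k, subset_closure hk⟩
      · exact ⟨none, hx⟩
  obtain ⟨x, hxU, hx⟩ := hd.inter_open_nonempty U hU hne
  obtain ⟨o, ho⟩ := mem_iUnion.1 hx
  rcases o with _ | k
  · exact absurd hxU (interior_subset ho)
  refine ⟨k, ?_⟩
  have hopen : IsOpen (U ∩ interior (closure {x | P k x})) := hU.inter isOpen_interior
  obtain ⟨V, hVU, hV, ⟨v, hv⟩, hdec⟩ := h (P k) (hP k) _ hopen ⟨x, hxU, ho⟩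
  refine ⟨V, fun y hy => (hVU hy).1, hV, ⟨v, hv⟩, ?_⟩
  rcases hdec with hd | hd
  · exact hd
  · obtain ⟨y, hy, hy2⟩ := mem_closure_iff.1 (interior_subset (hVU hv).2) V hV hv
    exact absurd hy2 (hd y hy)

theorem exists_rat_Ioo_subset {a b : ℝ} (h : a < b) :
    ∃ q : ℚ × ℚ, (q.1 : ℝ) < q.2 ∧ a < q.1 ∧ (q.2 : ℝ) < b := by
  obtain ⟨p, hp1, hp2⟩ := exists_rat_btwn h
  obtain ⟨q, hq1, hq2⟩ := exists_rat_btwn hp2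
  exact ⟨(p, q), by exact_mod_cast hq1, hp1, hq2⟩

theorem LocallyDecided.real_prod [OMin L] [BaireSpace F] (h : LocallyDecided L F) :
    LocallyDecided L (ℝ × F) := by
  intro P hP U hU ⟨u, hu⟩
  obtain ⟨I, hI, W, hW, hIW⟩ := mem_nhds_prod_iff.1 (hU.mem_nhds hu)
  obtain ⟨p, q, hpq, hIpq⟩ := mem_nhds_iff_exists_Ioo_subset.1 hI
  obtain ⟨B, hBW, hB, hBu⟩ := mem_nhds_iff.1 hW
  have hsub : ∀ x y, p < x → x < q → y ∈ B → (x, y) ∈ U := fun x y h1 h2 h3 =>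
    hIW ⟨hIpq ⟨h1, h2⟩, hBW h3⟩
  have hA : ∀ k : ℚ × ℚ, DP L (fun y : F => p < k.1 ∧ (k.1 : ℝ) < k.2 ∧ (k.2 : ℝ) < q ∧
      ∀ x : ℝ, (k.1 : ℝ) < x ∧ x < k.2 → P (x, y)) := by
    intro k
    simp only [imp_iff_not_or]
    fun_prop
  have hC : ∀ k : ℚ × ℚ, DP L (fun y : F => p < k.1 ∧ (k.1 : ℝ) < k.2 ∧ (k.2 : ℝ) < q ∧
      ∀ x : ℝ, (k.1 : ℝ) < x ∧ x < k.2 → ¬ P (x, y)) := by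
    intro k
    simp only [imp_iff_not_or]
    fun_prop
  have hE : DP L (fun y : F => ∃ a b : ℝ, p < a ∧ a < b ∧ b < q ∧
      ∀ x : ℝ, a < x ∧ x < b → P (x, y)) := by
    simp only [imp_iff_not_or]
    fun_prop
  obtain ⟨V, hVB, hV, hVne, hd⟩ := h _ hE B hB ⟨_, hBu⟩
  rcases hd with hd | hd
  · obtain ⟨k, V', hV'V, hV', hV'ne, hk⟩ := h.baire hA hV hVne (by
      intro y hy
      obtain ⟨a, b, h1, h2, h3, h4⟩ := hd y hy
      obtain ⟨k, hk1, hk2, hk3⟩ := exists_rat_Ioo_subset h2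
      exact ⟨k, h1.trans hk2, hk1, hk3.trans h3, fun x hx =>
        h4 x ⟨hk2.trans hx.1, hx.2.trans hk3⟩⟩)
    obtain ⟨y, hy⟩ := hV'ne
    obtain ⟨h1, h2, h3, -⟩ := hk y hy
    refine ⟨Ioo (k.1 : ℝ) k.2 ×ˢ V', ?_, isOpen_Ioo.prod hV', (nonempty_Ioo.2 h2).prod ⟨y, hy⟩,
      Or.inl ?_⟩
    · rintro ⟨x, y⟩ ⟨hx, hy⟩
      exact hsub x y (h1.trans hx.1) (hx.2.trans h3) (hVB (hV'V hy))
    · rintro ⟨x, y⟩ ⟨hx, hy⟩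
      exact (hk y hy).2.2.2 x hx
  · obtain ⟨k, V', hV'V, hV', hV'ne, hk⟩ := h.baire hC hV hVne (by
      intro y hy
      have hPy : DP L (fun x : ℝ => P (x, y)) := by fun_prop
      obtain ⟨J, hJ, hJo, ⟨j, hj⟩, hd'⟩ := locallyDecided_real (L := L) _ hPy (Ioo p q) isOpen_Ioo
        ⟨u.1, hpq⟩
      obtain ⟨a, b, hab, hJab⟩ := mem_nhds_iff_exists_Ioo_subset.1 (hJo.mem_nhds hj)
      obtain ⟨k, hk1, hk2, hk3⟩ := exists_rat_Ioo_subset (hab.1.trans hab.2)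
      obtain ⟨k', hk1', hk2', hk3'⟩ := exists_rat_Ioo_subset (show (k.1 : ℝ) < k.2 by exact hk1)
      have hs : ∀ x, (k.1 : ℝ) < x → x < k.2 → x ∈ J := fun x hx1 hx2 =>
        hJab ⟨hk2.trans hx1, hx2.trans hk3⟩
      have e1 := (hJ (hs k'.1 hk2' (hk1'.trans hk3'))).1
      have e2 := (hJ (hs k'.2 (hk2'.trans hk1') hk3')).2
      refine ⟨k', e1, hk1', e2, ?_⟩
      rcases hd' with hd' | hd'
      · exact absurd ⟨k'.1, k'.2, e1, hk1', e2, fun x hx =>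
          hd' x (hs x (hk2'.trans hx.1) (hx.2.trans hk3'))⟩ (hd y hy)
      · exact fun x hx => hd' x (hs x (hk2'.trans hx.1) (hx.2.trans hk3')))
    obtain ⟨y, hy⟩ := hV'ne
    obtain ⟨h1, h2, h3, -⟩ := hk y hy
    refine ⟨Ioo (k.1 : ℝ) k.2 ×ˢ V', ?_, isOpen_Ioo.prod hV', (nonempty_Ioo.2 h2).prod ⟨y, hy⟩,
      Or.inr ?_⟩
    · rintro ⟨x, y⟩ ⟨hx, hy⟩
      exact hsub x y (h1.trans hx.1) (hx.2.trans h3) (hVB (hV'V hy))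
    · rintro ⟨x, y⟩ ⟨hx, hy⟩
      exact (hk y hy).2.2.2 x hx

theorem LocallyDecided.transport (h : LocallyDecided L E) (e : E ≃ₜ F)
    (he : ∀ P : F → Prop, DP L P → DP L (fun x => P (e x))) : LocallyDecided L F := by
  intro P hP U hU ⟨u, hu⟩
  obtain ⟨V, hVU, hV, ⟨v, hv⟩, hd⟩ := h _ (he P hP) (e ⁻¹' U) (hU.preimage e.continuous)
    ⟨e.symm u, by simpa using hu⟩
  refine ⟨e.symm ⁻¹' V, ?_, hV.preimage e.symm.continuous, ⟨e v, by simpa using hv⟩, ?_⟩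
  · intro x hx
    simpa using hVU hx
  · refine hd.imp (fun hd x hx => ?_) (fun hd x hx => ?_)
    · simpa using hd _ hx
    · simpa using hd _ hx

theorem locallyDecided_fin [OMin L] (n : ℕ) : LocallyDecided L (Fin n → ℝ) := by
  induction n with
  | zero =>
    intro P hP U hU hne
    refine ⟨U, subset_rfl, hU, hne, ?_⟩
    by_cases h : P 0
    · exact Or.inl fun x _ => by rwa [Subsingleton.elim x 0]
    · exact Or.inr fun x _ => by rwa [Subsingleton.elim x 0]
  | succ n ih =>
    refine ih.real_prod.transport (Fin.consEquivL ℝ (fun _ : Fin (n + 1) => ℝ)).toHomeomorph ?_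
    intro P hP
    refine DP.comp hP ?_
    refine DF.pi fun i => ?_
    refine Fin.cases ?_ (fun j => ?_) i
    · exact DF.fst
    · change DF L (fun x : ℝ × (Fin n → ℝ) => x.2 j)
      fun_prop

theorem locallyDecided [OMin L] : LocallyDecided L E := by
  have := Coord.fin (E := E)
  obtain ⟨n, ⟨e⟩⟩ := Finite.exists_equiv_fin (Coord.ι E)
  have h1 : LocallyDecided L (Coord.ι E → ℝ) := by
    refine (locallyDecided_fin n).transport
      (Homeomorph.piCongrLeft (Y := fun _ => ℝ) e.symm) fun P hP => ?_
    refine DP.comp hP (DF.pi fun i => ?_)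
    have : (fun x : Fin n → ℝ => (Homeomorph.piCongrLeft (Y := fun _ => ℝ) e.symm) x i)
        = fun x => x (e i) := by
      ext x
      obtain ⟨j, rfl⟩ := e.symm.surjective i
      rw [e.apply_symm_apply]
      exact Equiv.piCongrLeft_apply_apply (P := fun _ => ℝ) e.symm x j
    rw [this]
    fun_prop
  exact h1.transport Coord.eqv.symm fun P hP => hP

theorem Coord.baireSpace : BaireSpace E := by
  have := Coord.fin (E := E)
  cases nonempty_fintype (Coord.ι E)
  exact (Coord.eqv (E := E)).symm.baireSpace

/-- Baire category theorem for countable covers by definable sets. -/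
theorem exists_open_of_cover [OMin L] {κ : Type} [Countable κ]
    {P : κ → E → Prop} (hP : ∀ k, DP L (P k)) {U : Set E} (hU : IsOpen U) (hne : U.Nonempty)
    (hcov : ∀ x ∈ U, ∃ k, P k x) :
    ∃ k, ∃ V ⊆ U, IsOpen V ∧ V.Nonempty ∧ ∀ x ∈ V, P k x :=
  have := Coord.baireSpace (E := E)
  locallyDecided.baire hP hU hne hcov

end Generic

/-! ### Generic smoothness of definable functions -/

section Smooth

variable {E F : Type} [TopologicalSpace E] [Coord E] [TopologicalSpace F] [Coord F]
variable {α β : Type} [Fintype α] [Fintype β]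

@[fun_prop]
theorem DP.eventually_nhds [OMin L] {P : E → (α → ℝ) → Prop} {g : E → α → ℝ}
    (hP : DP L (fun p : E × (α → ℝ) => P p.1 p.2)) (hg : DF L g) :
    DP L (fun x => ∀ᶠ y in 𝓝 (g x), P x y) := by
  simp only [Metric.eventually_nhds_iff, gt_iff_lt, imp_iff_not_or]
  fun_prop

@[fun_prop]
theorem DF.abs [OMin L] {f : E → ℝ} (hf : DF L f) : DF L (fun x => |f x|) := by
  simp only [abs_eq_max_neg]
  fun_prop

@[fun_prop]
theorem DP.eventually_nhds_real [OMin L] {P : E → ℝ → Prop} {g : E → ℝ}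
    (hP : DP L (fun p : E × ℝ => P p.1 p.2)) (hg : DF L g) :
    DP L (fun x => ∀ᶠ y in 𝓝 (g x), P x y) := by
  simp only [Metric.eventually_nhds_iff, gt_iff_lt, imp_iff_not_or, Real.dist_eq]
  fun_prop

theorem DP.continuousAt [OMin L] {g : E → (α → ℝ) → ℝ} {s : E → α → ℝ}
    (hg : DF L (fun p : E × (α → ℝ) => g p.1 p.2)) (hs : DF L s) :
    DP L (fun q => ContinuousAt (g q) (s q)) := by
  simp only [Metric.continuousAt_iff', Real.dist_eq, gt_iff_lt, imp_iff_not_or]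
  fun_prop

theorem DP.hasDerivAt [OMin L] {g : E → ℝ → ℝ} {s c : E → ℝ}
    (hg : DF L (fun p : E × ℝ => g p.1 p.2)) (hs : DF L s) (hc : DF L c) :
    DP L (fun q => HasDerivAt (g q) (c q) (s q)) := by
  simp only [hasDerivAt_iff_isLittleO, Asymptotics.isLittleO_iff, imp_iff_not_or,
    Real.norm_eq_abs, smul_eq_mul]
  fun_prop

theorem DP.differentiableAt_real [OMin L] {g : E → ℝ → ℝ} {s : E → ℝ}
    (hg : DF L (fun p : E × ℝ => g p.1 p.2)) (hs : DF L s) :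
    DP L (fun q => DifferentiableAt ℝ (g q) (s q)) := by
  have h1 : DP L (fun p : E × ℝ => HasDerivAt (g p.1) p.2 (s p.1)) :=
    DP.hasDerivAt (by fun_prop) (by fun_prop) (by fun_prop)
  have : DP L (fun q => ∃ c, HasDerivAt (g q) c (s q)) := DP.ex h1
  exact this.congr fun q => ⟨fun h => ⟨_, h.hasDerivAt⟩, fun ⟨c, h⟩ => h.differentiableAt⟩

theorem DF.deriv [OMin L] {g : E → ℝ → ℝ} {s : E → ℝ}
    (hg : DF L (fun p : E × ℝ => g p.1 p.2)) (hs : DF L s) :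
    DF L (fun q => deriv (g q) (s q)) := by
  have h1 : DP L (fun p : E × ℝ => HasDerivAt (g p.1) p.2 (s p.1)) :=
    DP.hasDerivAt (by fun_prop) (by fun_prop) (by fun_prop)
  have h2 : DP L (fun p : E × ℝ => DifferentiableAt ℝ (g p.1) (s p.1)) :=
    DP.differentiableAt_real (by fun_prop) (by fun_prop)
  have h3 : DP L (fun p : E × ℝ => HasDerivAt (g p.1) p.2 (s p.1) ∨
      (¬ DifferentiableAt ℝ (g p.1) (s p.1) ∧ p.2 = 0)) := by fun_prop
  refine DP.congr h3 fun p => ?_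
  by_cases h : DifferentiableAt ℝ (g p.1) (s p.1)
  · simp only [h, not_true, false_and, or_false]
    exact ⟨fun e => e ▸ h.hasDerivAt, fun e => e.deriv⟩
  · simp only [h, not_false_eq_true, true_and, deriv_zero_of_not_differentiableAt h]
    constructor
    · exact fun e => Or.inr e.symm
    · rintro (e | e)
      · exact absurd e.differentiableAt h
      · exact e.symm

@[fun_prop]
theorem DF.update [DecidableEq α] (i : α) {f : E → α → ℝ} {g : E → ℝ} (hf : DF L f)
    (hg : DF L g) : DF L (fun x => Function.update (f x) i (g x)) := by
  refine DF.pi fun j => ?_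
  by_cases h : j = i
  · subst h
    simpa using hg
  · simp only [Function.update_of_ne h]
    fun_prop

/-- The partial derivative of a function of several real variables. -/
noncomputable def pd [DecidableEq α] (g : (α → ℝ) → ℝ) (i : α) (x : α → ℝ) : ℝ :=
  deriv (fun t => g (Function.update x i t)) (x i)

@[fun_prop]
theorem DF.pd [OMin L] [DecidableEq α] (i : α) {g : E → (α → ℝ) → ℝ} {s : E → α → ℝ}
    (hg : DF L (fun p : E × (α → ℝ) => g p.1 p.2)) (hs : DF L s) :
    DF L (fun q => pd (g q) i (s q)) :=
  DF.deriv (g := fun q t => g q (Function.update (s q) i t)) (by fun_prop) (by fun_prop)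

theorem hasFDerivAt_of_partials [DecidableEq α] {g : (α → ℝ) → ℝ} {x : α → ℝ}
    (h : ∀ᶠ y in 𝓝 x, ∀ i, DifferentiableAt ℝ (fun t => g (Function.update y i t)) (y i))
    (hc : ∀ i, ContinuousAt (pd g i) x) :
    HasFDerivAt g (∑ i, pd g i x • (ContinuousLinearMap.proj i : (α → ℝ) →L[ℝ] ℝ)) x := by
  rw [hasFDerivAt_iff_isLittleO, Asymptotics.isLittleO_iff]
  intro c hc0
  set N : ℝ := Fintype.card α + 1
  have hN : 0 < N := by positivity
  have h1 : ∀ᶠ y in 𝓝 x, ∀ i, |pd g i y - pd g i x| ≤ c / N := by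
    rw [Filter.eventually_all]
    intro i
    have := Metric.continuousAt_iff'.1 (hc i) (c / N) (by positivity)
    filter_upwards [this] with y hy
    exact (Real.dist_eq _ _ ▸ hy).le
  obtain ⟨δ, hδ, hb⟩ := Metric.eventually_nhds_iff_ball.1 (h.and h1)
  have key : ∀ s : Finset α, ∀ y ∈ Metric.ball x δ, (∀ i ∉ s, y i = x i) →
      |g y - g x - ∑ i ∈ s, pd g i x * (y i - x i)| ≤ ∑ i ∈ s, c / N * |y i - x i| := by
    intro s
    induction s using Finset.induction_on with
    | empty =>
      intro y _ hy
      have : y = x := funext fun i => hy i (by simp)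
      simp [this]
    | insert a s ha ih =>
      intro y hy hyx
      have hupd : ∀ t ∈ Metric.ball (x a) δ, Function.update y a t ∈ Metric.ball x δ := by
        intro t ht
        rw [Metric.mem_ball, dist_pi_lt_iff hδ] at hy ⊢
        intro i
        by_cases hi : i = a
        · subst hi; simpa using ht
        · simpa [hi] using hy i
      set w := Function.update y a (x a) with hw
      have hwb : w ∈ Metric.ball x δ := hupd _ (Metric.mem_ball_self hδ)
      have hya : y a ∈ Metric.ball (x a) δ := by
        rw [Metric.mem_ball, dist_pi_lt_iff hδ] at hy
        exact hy a
      have hw1 := ih w hwb (by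
        intro i hi
        by_cases hia : i = a
        · subst hia; simp [hw]
        · rw [hw, Function.update_of_ne hia]
          exact hyx i (by simp [hia, hi]))
      have hs : ∀ i ∈ s, w i = y i := by
        intro i hi
        have : i ≠ a := fun e => ha (e ▸ hi)
        rw [hw, Function.update_of_ne this]
      have hs1 : ∑ i ∈ s, pd g i x * (w i - x i) = ∑ i ∈ s, pd g i x * (y i - x i) :=
        Finset.sum_congr rfl fun i hi => by rw [hs i hi]
      have hs2 : ∑ i ∈ s, c / N * |w i - x i| = ∑ i ∈ s, c / N * |y i - x i| :=
        Finset.sum_congr rfl fun i hi => by rw [hs i hi]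
      rw [hs1, hs2] at hw1
      have hd : ∀ t ∈ Metric.ball (x a) δ, HasDerivWithinAt
          (fun t => g (Function.update y a t) - pd g a x * t)
          (pd g a (Function.update y a t) - pd g a x) (Metric.ball (x a) δ) t := by
        intro t ht
        have e1 := ((hb _ (hupd t ht)).1 a).hasDerivAt
        simp only [Function.update_idem, Function.update_self] at e1
        have e2 := (hasDerivAt_id t).const_mul (pd g a x)
        have e3 := e1.sub e2
        have e4 : pd g a (Function.update y a t)
            = _root_.deriv (fun t => g (Function.update y a t)) t := by
          simp [pd]
        rw [e4]
        simpa using! e3.hasDerivWithinAt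
      have hm := Convex.norm_image_sub_le_of_norm_hasDerivWithin_le hd (C := c / N)
        (fun t ht => (hb _ (hupd t ht)).2 a) (convex_ball _ _) (Metric.mem_ball_self hδ) hya
      simp only [Function.update_eq_self, Real.norm_eq_abs] at hm
      rw [Finset.sum_insert ha, Finset.sum_insert ha]
      have : g y - g x - (pd g a x * (y a - x a) + ∑ i ∈ s, pd g i x * (y i - x i))
          = (g y - pd g a x * y a - (g w - pd g a x * x a)) +
            (g w - g x - ∑ i ∈ s, pd g i x * (y i - x i)) := by ring
      rw [this]
      exact (abs_add_le _ _).trans (add_le_add hm hw1)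
  filter_upwards [Metric.ball_mem_nhds x hδ] with y hy
  have := key Finset.univ y hy (by simp)
  simp only [Real.norm_eq_abs, sum_apply, smul_apply,
    ContinuousLinearMap.proj_apply, smul_eq_mul, Pi.sub_apply]
  refine this.trans ?_
  have h2 : ∀ i ∈ (Finset.univ : Finset α), c / N * |y i - x i| ≤ c / N * ‖y - x‖ := by
    intro i _
    exact mul_le_mul_of_nonneg_left (norm_le_pi_norm (y - x) i) (by positivity)
  refine (Finset.sum_le_sum h2).trans ?_
  rw [Finset.sum_const, nsmul_eq_mul, ← mul_assoc]
  refine mul_le_mul_of_nonneg_right ?_ (norm_nonneg _)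
  rw [mul_div_assoc', div_le_iff₀ hN, mul_comm]
  refine mul_le_mul_of_nonneg_left ?_ hc0.le
  simp [N]

theorem contDiffAt_succ_iff_pd [DecidableEq α] {g : (α → ℝ) → ℝ} {x : α → ℝ} (r : ℕ) :
    ContDiffAt ℝ (r + 1) g x ↔
      (∀ᶠ y in 𝓝 x, ∀ i, DifferentiableAt ℝ (fun t => g (Function.update y i t)) (y i)) ∧
        ∀ i, ContDiffAt ℝ r (pd g i) x := by
  have hpd : ∀ y, DifferentiableAt ℝ g y → ∀ i, HasDerivAt (fun t => g (Function.update y i t))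
      (fderiv ℝ g y (Pi.single i 1)) (y i) := by
    intro y hy i
    have h1 : HasFDerivAt g (fderiv ℝ g y) (Function.update y i (y i)) := by
      rw [Function.update_eq_self]
      exact hy.hasFDerivAt
    exact h1.comp_hasDerivAt (y i) (hasDerivAt_update y i (y i))
  constructor
  · intro h
    have h1 : ∀ᶠ y in 𝓝 x, DifferentiableAt ℝ g y := by
      filter_upwards [h.eventually (by simp)] with y hy
      exact hy.differentiableAt (by simp)
    refine ⟨h1.mono fun y hy i => (hpd y hy i).differentiableAt, fun i => ?_⟩
    have h2 : ContDiffAt ℝ r (fderiv ℝ g) x := h.fderiv_right le_rfl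
    have h3 : ContDiffAt ℝ r (fun y => fderiv ℝ g y (Pi.single i 1)) x :=
      h2.clm_apply contDiffAt_const
    refine h3.congr_of_eventuallyEq ?_
    filter_upwards [h1] with y hy
    exact (hpd y hy i).deriv
  · rintro ⟨h1, h2⟩
    rw [contDiffAt_succ_iff_hasFDerivAt]
    refine ⟨fun y => ∑ i, pd g i y • (ContinuousLinearMap.proj i : (α → ℝ) →L[ℝ] ℝ),
      ⟨_, ?_, fun y hy => hy⟩, ?_⟩
    · have h3 : ∀ᶠ y in 𝓝 x, ∀ i, ContinuousAt (pd g i) y := by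
        rw [Filter.eventually_all]
        intro i
        filter_upwards [(h2 i).eventually (by simp)] with y hy
        exact hy.continuousAt
      filter_upwards [h1.eventually_nhds, h3] with y hy1 hy2
      exact hasFDerivAt_of_partials hy1 hy2
    · exact ContDiffAt.sum fun i _ => (h2 i).smul contDiffAt_const

theorem DP.contDiffAt_real [OMin L] (r : ℕ) {g : E → (α → ℝ) → ℝ} {s : E → α → ℝ}
    (hg : DF L (fun p : E × (α → ℝ) => g p.1 p.2)) (hs : DF L s) :
    DP L (fun q => ContDiffAt ℝ r (g q) (s q)) := by
  classical
  induction r generalizing g with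
  | zero =>
    have h1 : DP L (fun p : E × (α → ℝ) => ContinuousAt (g p.1) p.2) :=
      DP.continuousAt (by fun_prop) (by fun_prop)
    have h2 : DP L (fun q : E => ∀ᶠ y in 𝓝 (s q), ContinuousAt (g q) y) := by fun_prop
    refine h2.congr fun q => ?_
    rw [Nat.cast_zero]
    constructor
    · intro h
      filter_upwards [h.eventually (by simp)] with y hy
      exact hy.continuousAt
    · intro h
      exact contDiffAt_zero.2 ⟨_, h, fun y hy => ContinuousAt.continuousWithinAt hy⟩
  | succ r ih =>
    have h1 : ∀ i : α, DP L (fun p : E × (α → ℝ) =>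
        DifferentiableAt ℝ (fun t => g p.1 (Function.update p.2 i t)) (p.2 i)) := fun i =>
      DP.differentiableAt_real (by fun_prop) (by fun_prop)
    have h2 : DP L (fun p : E × (α → ℝ) =>
        ∀ i, DifferentiableAt ℝ (fun t => g p.1 (Function.update p.2 i t)) (p.2 i)) :=
      DP.finite_all h1
    have h3 : DP L (fun q => ∀ᶠ y in 𝓝 (s q), ∀ i, DifferentiableAt ℝ (fun t =>
        g q (Function.update y i t)) (y i)) := DP.eventually_nhds h2 hs
    have h4 : DP L (fun q => ∀ i, ContDiffAt ℝ r (Paper.pd (g q) i) (s q)) :=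
      DP.finite_all fun i => ih (g := fun q => Paper.pd (g q) i) (by fun_prop)
    refine (h3.and h4).congr fun q => ?_
    exact_mod_cast contDiffAt_succ_iff_pd (g := g q) (x := s q) r

@[fun_prop]
theorem DP.contDiffAt [OMin L] (r : ℕ) {g : E → (α → ℝ) → β → ℝ} {s : E → α → ℝ}
    (hg : DF L (fun p : E × (α → ℝ) => g p.1 p.2)) (hs : DF L s) :
    DP L (fun q => ContDiffAt ℝ r (g q) (s q)) := by
  simp only [contDiffAt_pi]
  exact DP.finite_all fun i => DP.contDiffAt_real r (by fun_prop) hs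

/-- A predicate holds generically if every nonempty open set has a nonempty open subset
on which it holds. -/
def Generic {X : Type} [TopologicalSpace X] (P : X → Prop) : Prop :=
  ∀ U : Set X, IsOpen U → U.Nonempty → ∃ V ⊆ U, IsOpen V ∧ V.Nonempty ∧ ∀ x ∈ V, P x

theorem Generic.mono {X : Type} [TopologicalSpace X] {P Q : X → Prop} (hP : Generic P)
    (h : ∀ x, P x → Q x) : Generic Q := by
  intro U hU hne
  obtain ⟨V, h1, h2, h3, h4⟩ := hP U hU hne
  exact ⟨V, h1, h2, h3, fun x hx => h x (h4 x hx)⟩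

theorem Generic.and {X : Type} [TopologicalSpace X] {P Q : X → Prop} (hP : Generic P)
    (hQ : Generic Q) : Generic (fun x => P x ∧ Q x) := by
  intro U hU hne
  obtain ⟨V, h1, h2, h3, h4⟩ := hP U hU hne
  obtain ⟨W, k1, k2, k3, k4⟩ := hQ V h2 h3
  exact ⟨W, k1.trans h1, k2, k3, fun x hx => ⟨h4 x (k1 hx), k4 x hx⟩⟩

theorem Generic.finite_all {X κ : Type} [TopologicalSpace X] [Finite κ] {P : κ → X → Prop}
    (hP : ∀ k, Generic (P k)) : Generic (fun x => ∀ k, P k x) := by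
  classical
  cases nonempty_fintype κ
  have : ∀ s : Finset κ, Generic (fun x => ∀ k ∈ s, P k x) := by
    intro s
    induction s using Finset.induction_on with
    | empty => exact fun U hU hne => ⟨U, subset_rfl, hU, hne, by simp⟩
    | insert a s _ ih =>
      exact ((hP a).and ih).mono fun x hx => by simpa using hx
  exact (this Finset.univ).mono fun x hx k => hx k (by simp)

theorem Generic.eventually {X : Type} [TopologicalSpace X] {P : X → Prop} (hP : Generic P) :
    Generic (fun x => ∀ᶠ y in 𝓝 x, P y) := by
  intro U hU hne
  obtain ⟨V, h1, h2, h3, h4⟩ := hP U hU hne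
  exact ⟨V, h1, h2, h3, fun x hx => Filter.mem_of_superset (h2.mem_nhds hx) h4⟩

theorem generic_of_dense [OMin L] {P : E → Prop} (hP : DP L P)
    (h : ∀ U : Set E, IsOpen U → U.Nonempty → ∃ x ∈ U, P x) : Generic P := by
  intro U hU hne
  obtain ⟨V, hVU, hV, hVne, hd⟩ := locallyDecided P hP U hU hne
  refine ⟨V, hVU, hV, hVne, hd.resolve_right fun hd => ?_⟩
  obtain ⟨x, hx, hPx⟩ := h V hV hVne
  exact hd x hx hPx

theorem generic_continuousAt [OMin L] {g : (α → ℝ) → ℝ} (hg : DF L g) :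
    Generic (fun x => ContinuousAt g x) := by
  refine generic_of_dense (DP.continuousAt (g := fun _ => g) (s := fun x => x) (by fun_prop)
    (by fun_prop)) fun U hU hne => ?_
  let G : ℕ → Set (α → ℝ) := fun k =>
    {x | ∀ᶠ y in 𝓝 x, ∀ᶠ z in 𝓝 x, |g y - g z| < 1 / ((k : ℝ) + 1)}
  have hGo : ∀ k, IsOpen (interior (G k)) := fun k => isOpen_interior
  have hGd : ∀ k, Dense (interior (G k)) := by
    intro k
    rw [dense_iff_inter_open]
    intro W hW hWne
    obtain ⟨q, V, hVW, hV, ⟨v, hv⟩, hq⟩ := exists_open_of_cover (L := L) (κ := ℚ)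
      (P := fun q x => |g x - q| < 1 / ((k : ℝ) + 1) / 2) (fun q => by fun_prop) hW hWne (by
        intro x _
        obtain ⟨q, hq1, hq2⟩ := exists_rat_btwn
          (show g x < g x + 1 / ((k : ℝ) + 1) / 2 by 
            linarith [Nat.one_div_pos_of_nat (α := ℝ) (n := k)])
        exact ⟨q, abs_lt.2 ⟨by linarith, by linarith⟩⟩)
    refine ⟨v, hVW hv, mem_interior.2 ⟨V, fun x hx => ?_, hV, hv⟩⟩
    refine Filter.mem_of_superset (hV.mem_nhds hx) fun y hy =>
      Filter.mem_of_superset (hV.mem_nhds hx) fun z hz => ?_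
    change |g y - g z| < 1 / ((k : ℝ) + 1)
    have h1 := abs_lt.1 (hq y hy)
    have h2 := abs_lt.1 (hq z hz)
    exact abs_lt.2 ⟨by linarith [h1.1, h2.2], by linarith [h1.2, h2.1]⟩
  obtain ⟨x, hxU, hx⟩ := (dense_iInter_of_isOpen hGo hGd).inter_open_nonempty U hU hne
  refine ⟨x, hxU, Metric.continuousAt_iff'.2 fun ε hε => ?_⟩
  obtain ⟨k, hk⟩ := exists_nat_one_div_lt hε
  have h1 := interior_subset (mem_iInter.1 hx k)
  filter_upwards [h1] with y hy
  rw [Real.dist_eq]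
  exact (hy.self_of_nhds).trans hk

theorem monotoneOn_of_eventually_le {u : ℝ → ℝ} {J : Set ℝ} (hJ : OrdConnected J)
    (hc : ContinuousOn u J) (h : ∀ x ∈ J, ∀ᶠ y in 𝓝[>] x, u x ≤ u y) : MonotoneOn u J := by
  intro a ha b hb hab
  have hsub : Icc a b ⊆ J := hJ.out ha hb
  have hcl : IsClosed ({x | u a ≤ u x} ∩ Icc a b) := by
    have := (hc.mono hsub).preimage_isClosed_of_isClosed isClosed_Icc (isClosed_Ici (a := u a))
    rwa [inter_comm] at this
  refine hcl.Icc_subset_of_forall_exists_gt (mem_ofPred_eq ▸ le_rfl) ?_ ⟨hab, le_rfl⟩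
  rintro x ⟨hx, hxab⟩ y hy
  have h1 : ∀ᶠ z in 𝓝[>] x, z ∈ Ioc x y := Ioc_mem_nhdsGT hy
  obtain ⟨z, hz1, hz2⟩ := ((h x (hsub ⟨hxab.1, hxab.2.le⟩)).and h1).exists
  exact ⟨z, le_trans hx hz1, hz2⟩

theorem generic_differentiableAt_real [OMin L] {u : ℝ → ℝ} (hu : DF L u) :
    Generic (fun x => DifferentiableAt ℝ u x) := by
  refine generic_of_dense (DP.differentiableAt_real (g := fun _ => u) (s := fun x => x)
    (by fun_prop) (by fun_prop)) fun U hU hne => ?_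
  have hev : ∀ P : ℝ → ℝ → Prop, DP L (fun p : ℝ × ℝ => P p.1 p.2) →
      DP L (fun x => ∀ᶠ y in 𝓝[>] x, P x y) := by
    intro P hP
    simp only [eventually_nhdsWithin_iff, mem_Ioi, imp_iff_not_or]
    fun_prop
  have hcont : ∃ V ⊆ U, IsOpen V ∧ V.Nonempty ∧ ∀ x ∈ V, ContinuousAt u x := by
    have h1 : DF L (fun x : Unit → ℝ => u (x ())) := by fun_prop
    let e := Homeomorph.funUnique Unit ℝ
    obtain ⟨V, hVU, hV, ⟨v, hv⟩, hVc⟩ := generic_continuousAt h1 (e ⁻¹' U)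
      (hU.preimage e.continuous) ⟨e.symm hne.some, by simpa using hne.some_mem⟩
    refine ⟨e.symm ⁻¹' V, fun x hx => by simpa using hVU hx, hV.preimage e.symm.continuous,
      ⟨e v, by simpa using hv⟩, fun x hx => ?_⟩
    have h2 : ContinuousAt (fun x => u (e (e.symm x))) x :=
      ContinuousAt.comp (f := e.symm) (g := fun x : Unit → ℝ => u (x ())) (hVc _ hx)
        e.symm.continuous.continuousAt
    simpa using h2
  obtain ⟨V, hVU, hV, hVne, hVc⟩ := hcont
  have hd : ∃ W ⊆ V, IsOpen W ∧ W.Nonempty ∧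
      ((∀ x ∈ W, ∀ᶠ y in 𝓝[>] x, u x ≤ u y) ∨ (∀ x ∈ W, ∀ᶠ y in 𝓝[>] x, u y ≤ u x)) := by
    obtain ⟨W, hWV, hW, hWne, hd⟩ := locallyDecided (L := L) _
      (hev (fun x y => u x ≤ u y) (by fun_prop)) V hV hVne
    refine ⟨W, hWV, hW, hWne, hd.imp_right fun hd x hx => ?_⟩
    have : DP L (fun y => u x ≤ u y) := by fun_prop
    rcases decided_right this x with h | h
    · exact absurd h (hd x hx)
    · exact h.mono fun y hy => (not_le.1 hy).le
  obtain ⟨W, hWV, hW, ⟨w, hw⟩, hd⟩ := hd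
  obtain ⟨a, b, hab, hWab⟩ := mem_nhds_iff_exists_Ioo_subset.1 (hW.mem_nhds hw)
  have hc : ContinuousOn u (Ioo a b) := fun x hx =>
    (hVc x (hWV (hWab hx))).continuousWithinAt
  have hae : ∃ x ∈ Ioo a b, DifferentiableWithinAt ℝ u (Ioo a b) x := by
    have hpos : MeasureTheory.volume (Ioo a b) ≠ 0 := by
      simp [hab.1.trans hab.2]
    by_contra! hcon
    have h3 : ∀ᵐ x : ℝ, x ∈ Ioo a b → DifferentiableWithinAt ℝ u (Ioo a b) x := by
      rcases hd with hd | hd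
      · exact (monotoneOn_of_eventually_le ordConnected_Ioo hc fun x hx =>
          hd x (hWab hx)).ae_differentiableWithinAt_of_mem
      · have := (monotoneOn_of_eventually_le (u := fun x => - u x) ordConnected_Ioo hc.neg
          fun x hx => (hd x (hWab hx)).mono fun y hy =>
            neg_le_neg hy).ae_differentiableWithinAt_of_mem
        filter_upwards [this] with x hx hxm
        simpa using (hx hxm).neg
    refine hpos (MeasureTheory.measure_mono_null (fun x hx => ?_) h3)
    exact fun h4 => hcon x hx (h4 hx)
  obtain ⟨x, hx, hdx⟩ := hae
  exact ⟨x, hVU (hWV (hWab hx)), hdx.differentiableAt (isOpen_Ioo.mem_nhds hx)⟩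

theorem generic_contDiffAt_real [OMin L] (r : ℕ) {g : (α → ℝ) → ℝ} (hg : DF L g) :
    Generic (fun x => ContDiffAt ℝ r g x) := by
  classical
  induction r generalizing g with
  | zero =>
    refine (generic_continuousAt hg).eventually.mono fun x hx => ?_
    rw [Nat.cast_zero]
    exact contDiffAt_zero.2 ⟨_, hx, fun y hy => ContinuousAt.continuousWithinAt hy⟩
  | succ r ih =>
    have h1 : ∀ i, Generic (fun y : α → ℝ =>
        DifferentiableAt ℝ (fun t => g (Function.update y i t)) (y i)) := by
      intro i
      refine generic_of_dense (DP.differentiableAt_real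
        (g := fun (y : α → ℝ) t => g (Function.update y i t)) (s := fun y => y i)
        (by fun_prop) (by fun_prop)) fun U hU ⟨x, hx⟩ => ?_
      have hcont : Continuous (fun t => Function.update x i t) :=
        continuous_const.update i continuous_id
      obtain ⟨V, hVU, -, ⟨t, ht⟩, hd⟩ := generic_differentiableAt_real (L := L)
        (u := fun t => g (Function.update x i t)) (by fun_prop) _ (hU.preimage hcont)
        ⟨x i, by simpa using hx⟩
      exact ⟨Function.update x i t, hVU ht, by simpa using hd t ht⟩
    have h2 : ∀ i, Generic (fun x => ContDiffAt ℝ r (pd g i) x) := fun i =>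
      ih (DF.pd (E := α → ℝ) (g := fun _ => g) (s := fun x => x) i (by fun_prop) (by fun_prop))
    refine ((Generic.finite_all h1).eventually.and (Generic.finite_all h2)).mono fun x hx => ?_
    exact_mod_cast (contDiffAt_succ_iff_pd r).2 hx

/-- Definable maps are generically smooth. -/
theorem generic_contDiffAt [OMin L] (r : ℕ) {g : (α → ℝ) → β → ℝ} (hg : DF L g) :
    Generic (fun x => ContDiffAt ℝ r g x) := by
  simp only [contDiffAt_pi]
  exact Generic.finite_all fun i => generic_contDiffAt_real (L := L) r (by fun_prop)

end Smooth

/-! ### Local graphs and stratification -/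

section Strata

variable {α β κ : Type} [Fintype α] [Fintype β] [Finite κ]

/-- Restriction to the coordinates in `T`. -/
def res (T : Finset α) (x : α → ℝ) : T → ℝ := fun i => x i

theorem continuous_res {α : Type} (T : Finset α) : Continuous (res T) :=
  continuous_pi fun _ => continuous_apply _

theorem contDiff_res (T : Finset α) (r : ℕ) : ContDiff ℝ r (res T) :=
  contDiff_pi.2 fun i => contDiff_apply ℝ ℝ (i : α)

@[fun_prop]
theorem DF.res {E : Type} [TopologicalSpace E] [Coord E] (T : Finset α) {f : E → α → ℝ}
    (hf : DF L f) : DF L (fun x => res T (f x)) :=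
  DF.pi fun i => DF.comp (DF.apply (i : α)) hf

/-- Near `s` the set `Z` is the graph of the `C^r` map `H` over the coordinates in `T`. -/
structure LocGraph (r : ℕ) (Z : Set (α → ℝ)) (T : Finset α) (s : α → ℝ)
    (H : (T → ℝ) → α → ℝ) : Prop where
  smooth : ContDiffAt ℝ r H (res T s)
  base : H (res T s) = s
  proj : ∀ᶠ x in 𝓝 (res T s), res T (H x) = x
  mem : ∀ᶠ w in 𝓝 s, (w ∈ Z ↔ H (res T w) = w)

theorem LocGraph.mem_self {r : ℕ} {Z : Set (α → ℝ)} {T : Finset α} {s : α → ℝ}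
    {H : (T → ℝ) → α → ℝ} (h : LocGraph r Z T s H) : s ∈ Z :=
  h.mem.self_of_nhds.2 h.base

theorem LocGraph.eventually {r : ℕ} {Z : Set (α → ℝ)} {T : Finset α} {s : α → ℝ}
    {H : (T → ℝ) → α → ℝ} (h : LocGraph r Z T s H) :
    ∀ᶠ w in 𝓝 s, w ∈ Z → LocGraph r Z T w H := by
  have ht : Filter.Tendsto (res T) (𝓝 s) (𝓝 (res T s)) := (continuous_res T).continuousAt
  filter_upwards [ht.eventually (h.smooth.eventually (by simp)),
    ht.eventually h.proj.eventually_nhds, h.mem.eventually_nhds] with w h1 h2 h3 hw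
  exact ⟨h1, h3.self_of_nhds.1 hw, h2, h3⟩

theorem LocGraph.tendsto {r : ℕ} {Z : Set (α → ℝ)} {T : Finset α} {s : α → ℝ}
    {H : (T → ℝ) → α → ℝ} (h : LocGraph r Z T s H) :
    Filter.Tendsto H (𝓝 (res T s)) (𝓝 s) := by
  have := h.smooth.continuousAt.tendsto
  rwa [h.base] at this

theorem LocGraph.eventually_mem {r : ℕ} {Z : Set (α → ℝ)} {T : Finset α} {s : α → ℝ}
    {H : (T → ℝ) → α → ℝ} (h : LocGraph r Z T s H) :
    ∀ᶠ x in 𝓝 (res T s), H x ∈ Z := by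
  filter_upwards [h.tendsto.eventually h.mem, h.proj] with x h1 h2
  rw [h1, h2]

theorem LocGraph.closed {r : ℕ} {Z : Set (α → ℝ)} {T : Finset α} {s : α → ℝ}
    {H : (T → ℝ) → α → ℝ} (h : LocGraph r Z T s H) :
    ∀ᶠ w in 𝓝 s, w ∈ closure Z → w ∈ Z := by
  have ht : Filter.Tendsto (res T) (𝓝 s) (𝓝 (res T s)) := (continuous_res T).continuousAt
  filter_upwards [ht.eventually (h.smooth.eventually (by simp)), h.mem.eventually_nhds]
    with w h1 h2 hw
  rw [h2.self_of_nhds]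
  have hc : Filter.Tendsto (fun v => H (res T v)) (𝓝[Z] w) (𝓝 (H (res T w))) :=
    (ContinuousAt.comp (f := res T) h1.continuousAt
      (continuous_res T).continuousAt).mono_left nhdsWithin_le_nhds
  have hne : (𝓝[Z] w).NeBot := mem_closure_iff_nhdsWithin_neBot.1 hw
  have he : ∀ᶠ v in 𝓝[Z] w, H (res T v) = v := by
    rw [eventually_nhdsWithin_iff]
    exact h2.mono fun v hv => hv.1
  exact tendsto_nhds_unique (hc.congr' he) (Filter.tendsto_id.mono_left nhdsWithin_le_nhds)

/-- The point of `Z` in the ball of radius `ρ` about `s` which lies over `x`. -/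
noncomputable def localSection (Z : Set (α → ℝ)) (T : Finset α) (s : α → ℝ) (ρ : ℝ)
    (x : T → ℝ) : α → ℝ :=
  the fun w => w ∈ Z ∧ dist w s < ρ ∧ res T w = x

/-- The points at which `Z` is a local graph over the coordinates in `T`, the map `f` is `C^r`
on this graph, and membership of `f` in the sets `Yp i` is locally constant. -/
def Spec (r : ℕ) (Z : Set (α → ℝ)) (T : Finset α) (f : (α → ℝ) → β → ℝ)
    (Yp : κ → Set (β → ℝ)) : Set (α → ℝ) :=
  {s | (∃ H, LocGraph r Z T s H ∧ ContDiffAt ℝ r (fun x => f (H x)) (res T s)) ∧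
    ∀ i, ∀ᶠ w in 𝓝 s, w ∈ Z → (f w ∈ Yp i ↔ f s ∈ Yp i)}

theorem exists_locGraph_iff {r : ℕ} {Z : Set (α → ℝ)} {T : Finset α} {s : α → ℝ}
    {f : (α → ℝ) → β → ℝ} :
    (∃ H, LocGraph r Z T s H ∧ ContDiffAt ℝ r (fun x => f (H x)) (res T s)) ↔
      s ∈ Z ∧ ∃ ρ : ℝ, 0 < ρ ∧ ContDiffAt ℝ r (localSection Z T s ρ) (res T s) ∧
        ContDiffAt ℝ r (fun x => f (localSection Z T s ρ x)) (res T s) ∧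
        (∀ᶠ x in 𝓝 (res T s), localSection Z T s ρ x ∈ Z ∧ dist (localSection Z T s ρ x) s < ρ ∧
          res T (localSection Z T s ρ x) = x) ∧
        ∀ w w', (w ∈ Z ∧ dist w s < ρ) ∧ (w' ∈ Z ∧ dist w' s < ρ) ∧ res T w = res T w' →
          w = w' := by
  constructor
  · rintro ⟨H, h, hf⟩
    obtain ⟨ρ, hρ, hb⟩ := Metric.eventually_nhds_iff.1 h.mem
    have huniq : ∀ w w', (w ∈ Z ∧ dist w s < ρ) ∧ (w' ∈ Z ∧ dist w' s < ρ) ∧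
        res T w = res T w' → w = w' := by
      rintro w w' ⟨⟨h1, h2⟩, ⟨h3, h4⟩, h5⟩
      rw [← (hb h2).1 h1, ← (hb h4).1 h3, h5]
    have hball : ∀ᶠ x in 𝓝 (res T s), dist (H x) s < ρ :=
      h.tendsto.eventually (Metric.ball_mem_nhds s hρ)
    have heq : localSection Z T s ρ =ᶠ[𝓝 (res T s)] H := by
      filter_upwards [h.proj, h.eventually_mem, hball] with x h1 h2 h3
      exact the_eq ⟨h2, h3, h1⟩ fun w ⟨hw1, hw2, hw3⟩ =>
        huniq _ _ ⟨⟨hw1, hw2⟩, ⟨h2, h3⟩, hw3.trans h1.symm⟩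
    refine ⟨h.mem_self, ρ, hρ, h.smooth.congr_of_eventuallyEq heq,
      hf.congr_of_eventuallyEq (heq.mono fun x hx => congrArg f hx), ?_, huniq⟩
    filter_upwards [heq, h.proj, h.eventually_mem, hball] with x h0 h1 h2 h3
    rw [h0]
    exact ⟨h2, h3, h1⟩
  · rintro ⟨hs, ρ, hρ, h1, h2, h3, h4⟩
    have ht : Filter.Tendsto (res T) (𝓝 s) (𝓝 (res T s)) := (continuous_res T).continuousAt
    have key : ∀ᶠ w in 𝓝 s, (w ∈ Z ↔ localSection Z T s ρ (res T w) = w) := by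
      filter_upwards [ht.eventually h3, Metric.ball_mem_nhds s hρ] with w hw1 hw2
      constructor
      · intro hw
        exact h4 _ _ ⟨⟨hw1.1, hw1.2.1⟩, ⟨hw, hw2⟩, hw1.2.2⟩
      · intro hw
        exact hw ▸ hw1.1
    exact ⟨localSection Z T s ρ, ⟨h1, key.self_of_nhds.1 hs, h3.mono fun x hx => hx.2.2, key⟩, h2⟩

theorem DS.spec [OMin L] {r : ℕ} {Z : Set (α → ℝ)} {T : Finset α}
    {f : (α → ℝ) → β → ℝ} {Yp : κ → Set (β → ℝ)} (hZ : DS L Z) (hf : DF L f)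
    (hY : ∀ i, DS L (Yp i)) : DS L (Spec r Z T f Yp) := by
  have h0 : DP L (fun p : (((α → ℝ) × ℝ) × (T → ℝ)) × (α → ℝ) =>
      p.2 ∈ Z ∧ dist p.2 p.1.1.1 < p.1.1.2 ∧ res T p.2 = p.1.2) := by fun_prop
  have h1 : DF L (fun p : ((α → ℝ) × ℝ) × (T → ℝ) => localSection Z T p.1.1 p.1.2 p.2) :=
    DF.the (P := fun (p : ((α → ℝ) × ℝ) × (T → ℝ)) w =>
      w ∈ Z ∧ dist w p.1.1 < p.1.2 ∧ res T w = p.2) h0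
  have h2 : DP L (fun s => ∃ H, LocGraph r Z T s H ∧
      ContDiffAt ℝ r (fun x => f (H x)) (res T s)) := by
    simp only [exists_locGraph_iff, imp_iff_not_or]
    fun_prop
  have h3 : DP L (fun s => ∀ i, ∀ᶠ w in 𝓝 s, w ∈ Z → (f w ∈ Yp i ↔ f s ∈ Yp i)) := by
    simp only [imp_iff_not_or]
    refine DP.finite_all fun i => ?_
    have := hY i
    fun_prop
  exact h2.and h3

theorem Spec.subset {κ : Type} {r : ℕ} {Z : Set (α → ℝ)} {T : Finset α}
    {f : (α → ℝ) → β → ℝ} {Yp : κ → Set (β → ℝ)} : Spec r Z T f Yp ⊆ Z :=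
  fun _ ⟨⟨_, h, _⟩, _⟩ => h.mem_self

theorem Spec.eventually {r : ℕ} {Z : Set (α → ℝ)} {T : Finset α}
    {f : (α → ℝ) → β → ℝ} {Yp : κ → Set (β → ℝ)} {s : α → ℝ} (hs : s ∈ Spec r Z T f Yp) :
    ∀ᶠ w in 𝓝 s, w ∈ Z → w ∈ Spec r Z T f Yp := by
  obtain ⟨⟨H, h, hf⟩, hY⟩ := hs
  have ht : Filter.Tendsto (res T) (𝓝 s) (𝓝 (res T s)) := (continuous_res T).continuousAt
  have hY' := Filter.eventually_all.2 fun i => (hY i).eventually_nhds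
  filter_upwards [h.eventually, ht.eventually (hf.eventually (by simp)), hY'] with w h1 h2 h3 hw
  refine ⟨⟨H, h1 hw, h2⟩, fun i => ?_⟩
  filter_upwards [h3 i] with v hv hvZ
  rw [hv hvZ, (h3 i).self_of_nhds hw]

/-- The set `Spec` inherits the local graph structure. -/
theorem Spec.locGraph {r : ℕ} {Z : Set (α → ℝ)} {T : Finset α}
    {f : (α → ℝ) → β → ℝ} {Yp : κ → Set (β → ℝ)} {s : α → ℝ} (hs : s ∈ Spec r Z T f Yp) :
    ∃ H, LocGraph r (Spec r Z T f Yp) T s H ∧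
      ContDiffAt ℝ r (fun x => f (H x)) (res T s) := by
  have hev := Spec.eventually hs
  obtain ⟨⟨H, h, hf⟩, -⟩ := hs
  refine ⟨H, ⟨h.smooth, h.base, h.proj, ?_⟩, hf⟩
  filter_upwards [h.mem, hev] with w h1 h2
  rw [← h1]
  exact ⟨fun hw => Spec.subset hw, h2⟩

/-- The projection of `Z` to the coordinates in `T` has nonempty interior. -/
def Big (Z : Set (α → ℝ)) (T : Finset α) : Prop := (interior (res T '' Z)).Nonempty

theorem Big.mono {α : Type} {Z Z' : Set (α → ℝ)} {T : Finset α} (h : Big Z T) (hZ : Z ⊆ Z') :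
    Big Z' T :=
  Set.Nonempty.mono (interior_mono (image_mono hZ)) h

theorem big_empty {α : Type} {Z : Set (α → ℝ)} (h : Z.Nonempty) : Big Z ∅ := by
  have : res (∅ : Finset α) '' Z = univ := by
    refine eq_univ_of_forall fun x => ?_
    obtain ⟨z, hz⟩ := h
    exact ⟨z, hz, Subsingleton.elim _ _⟩
  rw [Big, this, interior_univ]
  exact univ_nonempty

theorem generic_fiber [OMin L] [DecidableEq α] {Z : Set (α → ℝ)} {T : Finset α} {j : α}
    (hZ : DS L Z) (hj : j ∉ T) (hb : ¬ Big Z (insert j T)) :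
    Generic (fun x : T → ℝ => ¬ ∃ p q : ℝ, p < q ∧ ∀ t, p < t ∧ t < q →
      ∃ w ∈ Z, res T w = x ∧ w j = t) := by
  have hdef : DP L (fun x : T → ℝ => ∃ p q : ℝ, p < q ∧ ∀ t, p < t ∧ t < q →
      ∃ w ∈ Z, res T w = x ∧ w j = t) := by
    simp only [imp_iff_not_or]
    fun_prop
  have hk : ∀ k : ℚ × ℚ, DP L (fun x : T → ℝ => (k.1 : ℝ) < k.2 ∧ ∀ t : ℝ, k.1 < t ∧ t < k.2 →
      ∃ w ∈ Z, res T w = x ∧ w j = t) := by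
    intro k
    simp only [imp_iff_not_or]
    fun_prop
  intro U hU hne
  obtain ⟨V, hVU, hV, hVne, hd⟩ := locallyDecided _ hdef U hU hne
  refine ⟨V, hVU, hV, hVne, hd.resolve_left fun hd => hb ?_⟩
  obtain ⟨k, W, hWV, hW, ⟨w, hw⟩, hkW⟩ := exists_open_of_cover hk hV hVne (by
    intro x hx
    obtain ⟨p, q, hpq, h⟩ := hd x hx
    obtain ⟨k, h1, h2, h3⟩ := exists_rat_Ioo_subset hpq
    exact ⟨k, h1, fun t ht => h t ⟨h2.trans ht.1, ht.2.trans h3⟩⟩)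
  let c1 : (↥(insert j T) → ℝ) → (T → ℝ) := fun y i => y ⟨i, Finset.mem_insert_of_mem i.2⟩
  have hc1 : Continuous c1 := continuous_pi fun i => continuous_apply _
  let c2 : (↥(insert j T) → ℝ) → ℝ := fun y => y ⟨j, Finset.mem_insert_self j T⟩
  have hc2 : Continuous c2 := continuous_apply _
  obtain ⟨t, ht1, ht2⟩ := exists_between (hkW w hw).1
  refine ⟨fun i => if h : (i : α) ∈ T then w ⟨i, h⟩ else t, mem_interior.2
    ⟨c1 ⁻¹' W ∩ c2 ⁻¹' Ioo (k.1 : ℝ) k.2, ?_,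
      (hW.preimage hc1).inter (isOpen_Ioo.preimage hc2), ?_, ?_⟩⟩
  · rintro y ⟨hy1, hy2⟩
    obtain ⟨z, hz, hz1, hz2⟩ := (hkW _ hy1).2 _ hy2
    refine ⟨z, hz, funext fun i => ?_⟩
    rcases Finset.mem_insert.1 i.2 with hi | hi
    · have : i = ⟨j, Finset.mem_insert_self j T⟩ := Subtype.ext hi
      rw [this]
      exact hz2
    · exact congrFun hz1 ⟨i, hi⟩
  · have : c1 (fun i => if h : (i : α) ∈ T then w ⟨i, h⟩ else t) = w := by
      ext i
      simp [c1]
    rwa [mem_preimage, this]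
  · simpa [c2, hj] using ⟨ht1, ht2⟩

theorem eventually_notMem_of_not_interval [OMin L] {P : ℝ → Prop} (hP : DP L P)
    (h : ¬ ∃ p q : ℝ, p < q ∧ ∀ t, p < t ∧ t < q → P t) (a : ℝ) : ∀ᶠ t in 𝓝[≠] a, ¬ P t := by
  rw [← nhdsLT_sup_nhdsGT, Filter.eventually_sup]
  constructor
  · refine (decided_left hP a).resolve_left fun h1 => h ?_
    obtain ⟨b, hb, hs⟩ := mem_nhdsLT_iff_exists_Ioo_subset.1 h1
    exact ⟨b, a, hb, fun t ht => hs ht⟩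
  · refine (decided_right hP a).resolve_left fun h1 => h ?_
    obtain ⟨b, hb, hs⟩ := mem_nhdsGT_iff_exists_Ioo_subset.1 h1
    exact ⟨a, b, hb, fun t ht => hs ht⟩

theorem generic_decided [OMin L] {E : Type} [TopologicalSpace E] [Coord E] {P : E → Prop}
    (hP : DP L P) : Generic (fun x => Decided (𝓝 x) P) := by
  intro U hU hne
  obtain ⟨V, hVU, hV, hVne, hd⟩ := locallyDecided P hP U hU hne
  refine ⟨V, hVU, hV, hVne, fun x hx => ?_⟩
  exact hd.imp (fun hd => Filter.mem_of_superset (hV.mem_nhds hx) hd)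
    (fun hd => Filter.mem_of_superset (hV.mem_nhds hx) hd)

theorem exists_rat_ball {z : α → ℝ} {U : Set (α → ℝ)} (hU : U ∈ 𝓝 z) :
    ∃ k : (α → ℚ) × ℚ, dist z (fun i => (k.1 i : ℝ)) < k.2 ∧
      ∀ w, dist w (fun i => (k.1 i : ℝ)) < k.2 → w ∈ U := by
  obtain ⟨ε, hε, hb⟩ := Metric.mem_nhds_iff.1 hU
  obtain ⟨q, hq1, hq2⟩ := exists_rat_btwn (show (0 : ℝ) < ε / 2 by positivity)
  have : ∀ i, ∃ c : ℚ, |z i - c| < q := fun i => by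
    obtain ⟨c, hc1, hc2⟩ := exists_rat_btwn (show z i < z i + q by linarith)
    exact ⟨c, abs_lt.2 ⟨by linarith, by linarith⟩⟩
  choose c hc using this
  have hz : dist z (fun i => (c i : ℝ)) < q := (dist_pi_lt_iff hq1).2 fun i => hc i
  refine ⟨(c, q), hz, fun w hw => hb ?_⟩
  rw [Metric.mem_ball]
  have := dist_triangle_right w z (fun i => (c i : ℝ))
  have hw' : dist w (fun i => (c i : ℝ)) < q := hw
  linarith

theorem not_big_diff_spec [OMin L] [DecidableEq α] (r : ℕ) {Z : Set (α → ℝ)} {T : Finset α}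
    {f : (α → ℝ) → β → ℝ} {Yp : κ → Set (β → ℝ)} (hZ : DS L Z) (hf : DF L f)
    (hY : ∀ i, DS L (Yp i)) (hT : ∀ j ∉ T, ¬ Big Z (insert j T)) :
    ¬ Big (Z \ Spec r Z T f Yp) T := by
  intro hbig
  have hS : DS L (Spec r Z T f Yp) := DS.spec hZ hf hY
  have hfib : Generic (fun x : T → ℝ => ∀ j, j ∉ T → ¬ ∃ p q : ℝ, p < q ∧ ∀ t, p < t ∧ t < q →
      ∃ w ∈ Z, res T w = x ∧ w j = t) := by
    refine Generic.finite_all fun j => ?_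
    by_cases hj : j ∈ T
    · exact fun U hU hne => ⟨U, subset_rfl, hU, hne, by simp [hj]⟩
    · exact (generic_fiber hZ hj (hT j hj)).mono fun x hx _ => hx
  obtain ⟨V, hVU, hV, hVne, hVf⟩ := hfib _ isOpen_interior hbig
  have hiso : ∀ x ∈ V, ∀ z : α → ℝ, res T z = x → ∀ᶠ w in 𝓝 z, w ∈ Z ∧ res T w = x → w = z := by
    intro x hx z hz
    have h1 : ∀ j, ∀ᶠ w in 𝓝 z, w ∈ Z ∧ res T w = x → w j = z j := by
      intro j
      by_cases hj : j ∈ T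
      · refine Filter.Eventually.of_forall fun w hw => ?_
        exact congrFun (hw.2.trans hz.symm) ⟨j, hj⟩
      · have h2 := eventually_notMem_of_not_interval (L := L)
          (P := fun t => ∃ w ∈ Z, res T w = x ∧ w j = t) (by fun_prop) (hVf x hx j hj) (z j)
        rw [eventually_nhdsWithin_iff] at h2
        filter_upwards [(continuous_apply j).continuousAt.tendsto.eventually h2] with w hw hwZ
        by_contra hne
        exact hw hne ⟨w, hwZ.1, hwZ.2, rfl⟩
    filter_upwards [Filter.eventually_all.2 h1] with w hw hwZ
    exact funext fun j => hw j hwZ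
  obtain ⟨k, V1, hV1V, hV1, hV1ne, hk⟩ := exists_open_of_cover (L := L)
    (κ := (α → ℚ) × ℚ) (P := fun k (x : T → ℝ) => ∃ z, (z ∈ Z ∧ z ∉ Spec r Z T f Yp) ∧
      res T z = x ∧ dist z (fun i => (k.1 i : ℝ)) < k.2 ∧
      ∀ w, w ∈ Z ∧ dist w (fun i => (k.1 i : ℝ)) < k.2 ∧ res T w = x → w = z)
    (fun k => by simp only [imp_iff_not_or]; fun_prop) hV hVne (by
      intro x hx
      obtain ⟨z, hz, hzx⟩ := interior_subset (hVU hx)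
      obtain ⟨k, hk1, hk2⟩ := exists_rat_ball (hiso x hx z hzx)
      exact ⟨k, z, hz, hzx, hk1, fun w hw => hk2 w hw.2.1 ⟨hw.1, hw.2.2⟩⟩)
  set c : α → ℝ := fun i => (k.1 i : ℝ) with hc
  let h : (T → ℝ) → α → ℝ := localSection Z T c k.2
  have hh : ∀ x ∈ V1, (h x ∈ Z ∧ h x ∉ Spec r Z T f Yp) ∧ res T (h x) = x ∧
      dist (h x) c < k.2 ∧ ∀ w, w ∈ Z ∧ dist w c < k.2 ∧ res T w = x → w = h x := by
    intro x hx
    obtain ⟨z, hz1, hz2, hz3, hz4⟩ := hk x hx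
    have : h x = z := the_eq ⟨hz1.1, hz3, hz2⟩ hz4
    rw [this]
    exact ⟨hz1, hz2, hz3, hz4⟩
  have hdf : DF L h := DF.the (P := fun (x : T → ℝ) w => w ∈ Z ∧ dist w c < k.2 ∧ res T w = x)
    (by fun_prop)
  have hgen : Generic (fun x : T → ℝ => (ContDiffAt ℝ r h x ∧
      ContDiffAt ℝ r (fun x => f (h x)) x) ∧ ∀ i, Decided (𝓝 x) (fun x => f (h x) ∈ Yp i)) := by
    refine ((generic_contDiffAt r hdf).and (generic_contDiffAt (L := L) r (by fun_prop))).and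
      (Generic.finite_all fun i => generic_decided (L := L) ?_)
    have := hY i
    fun_prop
  obtain ⟨V2, hV21, hV2, ⟨x, hx⟩, hV2p⟩ := hgen V1 hV1 hV1ne
  obtain ⟨⟨hc1, hc2⟩, hdec⟩ := hV2p x hx
  obtain ⟨⟨hsZ, hsS⟩, hsx, hsc, hsu⟩ := hh x (hV21 hx)
  have hpre : ∀ᶠ w in 𝓝 (h x), res T w ∈ V2 := by
    have : V2 ∈ 𝓝 (res T (h x)) := by rw [hsx]; exact hV2.mem_nhds hx
    exact (continuous_res T).continuousAt.eventually this
  have hball : ∀ᶠ w in 𝓝 (h x), dist w c < k.2 := Metric.isOpen_ball.mem_nhds hsc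
  have hmem : ∀ᶠ w in 𝓝 (h x), (w ∈ Z ↔ h (res T w) = w) := by
    filter_upwards [hpre, hball] with w hw1 hw2
    constructor
    · exact fun hw => ((hh _ (hV21 hw1)).2.2.2 w ⟨hw, hw2, rfl⟩).symm
    · intro hw
      rw [← hw]
      exact (hh _ (hV21 hw1)).1.1
  refine hsS ⟨⟨h, ⟨by rwa [hsx], by rw [hsx], ?_, hmem⟩, by rwa [hsx]⟩, fun i => ?_⟩
  · rw [hsx]
    exact Filter.mem_of_superset (hV2.mem_nhds hx) fun y hy => (hh y (hV21 hy)).2.1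
  · have ht : Filter.Tendsto (res T) (𝓝 (h x)) (𝓝 x) := by
      have := (continuous_res T).continuousAt (x := h x)
      rwa [ContinuousAt, hsx] at this
    rcases hdec i with hd | hd
    · filter_upwards [ht.eventually hd, hmem] with w hw1 hw2 hwZ
      rw [hw2.1 hwZ] at hw1
      exact iff_of_true hw1 hd.self_of_nhds
    · filter_upwards [ht.eventually hd, hmem] with w hw1 hw2 hwZ
      rw [hw2.1 hwZ] at hw1
      exact iff_of_false hw1 hd.self_of_nhds

end Strata

/-! ### Radius functions, `C^r` germs and bump functions -/

section Tools

variable {E F : Type} [TopologicalSpace E] [Coord E]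

theorem DF.of_lt [OMin L] {g : E → ℝ} (h : DP L (fun p : E × ℝ => g p.1 < p.2)) : DF L g := by
  have : DP L (fun p : E × ℝ => ∀ c : ℝ, g p.1 < c ↔ p.2 < c) := by
    have h' : DP L (fun q : (E × ℝ) × ℝ => g q.1.1 < q.2) :=
      DP.comp (f := fun q : (E × ℝ) × ℝ => (q.1.1, q.2)) h (by fun_prop)
    exact DP.all (DP.iff h' (by fun_prop))
  refine this.congr fun p => ⟨fun hp => by simp [hp], fun hp => ?_⟩
  exact eq_of_forall_gt_iff hp

/-- A definable relation holding near a diagonal point holds on a ball of definable continuous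
radius. -/
theorem exists_radius [OMin L] {α : Type} [Fintype α] {A : (α → ℝ) × (α → ℝ) → Prop} (hA : DP L A) :
    ∃ R : (α → ℝ) → ℝ, DF L R ∧ Continuous R ∧ (∀ s, 0 ≤ R s ∧ R s ≤ 1) ∧
      (∀ s, (∀ᶠ p in 𝓝 (s, s), A p) → 0 < R s) ∧
      ∀ s w w', dist w s < R s → dist w' s < R s → A (w, w') := by
  by_cases hne : ∃ p, ¬ A p
  · set C : Set ((α → ℝ) × (α → ℝ)) := {p | ¬ A p} with hC
    have hne : C.Nonempty := hne
    have hCd : DS L C := hA.not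
    refine ⟨fun s => min 1 (Metric.infDist (s, s) C), ?_, ?_, ?_, ?_, ?_⟩
    · have : DF L (fun s : α → ℝ => Metric.infDist (s, s) C) := by
        refine DF.of_lt ?_
        have : DP L (fun p : (α → ℝ) × ℝ => ∃ w w', ¬ A (w, w') ∧ dist p.1 w < p.2 ∧
            dist p.1 w' < p.2) := by
          change DP L (fun p : (α → ℝ) × ℝ => ∃ w w', (w, w') ∈ C ∧ dist p.1 w < p.2 ∧
            dist p.1 w' < p.2)
          fun_prop
        refine this.congr fun p => ?_
        rw [Metric.infDist_lt_iff hne]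
        constructor
        · rintro ⟨y, hy, h⟩
          rw [Prod.dist_eq, max_lt_iff] at h
          exact ⟨y.1, y.2, hy, h⟩
        · rintro ⟨w, w', hy, h⟩
          refine ⟨(w, w'), hy, ?_⟩
          rw [Prod.dist_eq, max_lt_iff]
          exact h
      exact DF.min (by fun_prop) this
    · have := Metric.continuous_infDist_pt C
      fun_prop
    · exact fun s => ⟨le_min zero_le_one Metric.infDist_nonneg, min_le_left _ _⟩
    · intro s hs
      refine lt_min zero_lt_one ((Metric.infDist_pos_iff_notMem_closure hne (x := (s, s))).1 fun hcl => ?_)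
      obtain ⟨p, hp1, hp2⟩ := (mem_closure_iff_frequently.1 hcl).and_eventually hs |>.exists
      exact hp1 hp2
    · intro s w w' hw hw'
      by_contra hcon
      have h1 : Metric.infDist (s, s) C ≤ dist (s, s) (w, w') :=
        Metric.infDist_le_dist_of_mem hcon
      rw [Prod.dist_eq] at h1
      have h2 := hw.trans_le (min_le_right _ _)
      have h3 := hw'.trans_le (min_le_right _ _)
      rw [dist_comm] at h2 h3
      exact absurd (max_lt h2 h3) (not_lt.2 h1)
  · push Not at hne
    exact ⟨fun _ => 1, by fun_prop, continuous_const, fun s => by norm_num,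
      fun s _ => one_pos, fun s w w' _ _ => hne _⟩

end Tools

/-- `F` agrees on `X` near `a` with a map which is `C^r` at `a`. -/
def CrAt {E F : Type} [NormedAddCommGroup E] [NormedSpace ℝ E] [NormedAddCommGroup F]
    [NormedSpace ℝ F] (r : ℕ) (X : Set E) (f : E → F) (a : E) : Prop :=
  ∃ g, ContDiffAt ℝ r g a ∧ ∀ᶠ z in 𝓝[X] a, f z = g z

section CrAt

variable {E F G : Type} [NormedAddCommGroup E] [NormedSpace ℝ E] [NormedAddCommGroup F]
  [NormedSpace ℝ F] [NormedAddCommGroup G] [NormedSpace ℝ G] {r : ℕ} {X : Set E} {a : E}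

theorem CrAt.eq_of_mem {E F : Type} [TopologicalSpace E] {X : Set E} {a : E} {f g : E → F}
    (h : ∀ᶠ z in 𝓝[X] a, f z = g z) (ha : a ∈ X) : f a = g a :=
  h.self_of_nhdsWithin ha

theorem CrAt.continuousWithinAt {f : E → F} (hf : CrAt r X f a) (ha : a ∈ X) :
    ContinuousWithinAt f X a := by
  obtain ⟨g, hg, h⟩ := hf
  exact (hg.continuousAt.continuousWithinAt).congr_of_eventuallyEq h (CrAt.eq_of_mem h ha)

theorem CrAt.congr {f g : E → F} (hg : CrAt r X g a) (h : ∀ᶠ z in 𝓝[X] a, f z = g z) :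
    CrAt r X f a := by
  obtain ⟨k, hk, h'⟩ := hg
  exact ⟨k, hk, by filter_upwards [h, h'] with z h1 h2 using h1.trans h2⟩

theorem CrAt.of_contDiffAt {f : E → F} (hf : ContDiffAt ℝ r f a) : CrAt r X f a :=
  ⟨f, hf, Filter.Eventually.of_forall fun _ => rfl⟩

theorem CrAt.prodMk {f : E → F} {g : E → G} (hf : CrAt r X f a) (hg : CrAt r X g a) :
    CrAt r X (fun z => (f z, g z)) a := by
  obtain ⟨f', hf', h1⟩ := hf
  obtain ⟨g', hg', h2⟩ := hg
  refine ⟨fun z => (f' z, g' z), hf'.prodMk hg', ?_⟩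
  filter_upwards [h1, h2] with z h1 h2
  rw [h1, h2]

theorem CrAt.comp_contDiffAt {f : E → F} {k : F → G} (hf : CrAt r X f a) (ha : a ∈ X)
    (hk : ContDiffAt ℝ r k (f a)) : CrAt r X (fun z => k (f z)) a := by
  obtain ⟨g, hg, h⟩ := hf
  rw [CrAt.eq_of_mem h ha] at hk
  exact ⟨fun z => k (g z), hk.comp a hg, h.mono fun z hz => congrArg k hz⟩

end CrAt

/-! #### Bump functions -/

theorem hasDerivAt_max_pow (k : ℕ) (x : ℝ) :
    HasDerivAt (fun t : ℝ => max t 0 ^ (k + 2)) ((k + 2) * max x 0 ^ (k + 1)) x := by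
  rcases lt_trichotomy x 0 with h | h | h
  · have he : (fun t : ℝ => max t 0 ^ (k + 2)) =ᶠ[𝓝 x] fun _ => 0 := by
      filter_upwards [Iio_mem_nhds h] with t ht
      rw [max_eq_right (le_of_lt ht), zero_pow (by omega)]
    rw [max_eq_right h.le, zero_pow (by omega), mul_zero]
    exact (hasDerivAt_const x (0 : ℝ)).congr_of_eventuallyEq he
  · subst h
    simp only [max_self]
    rw [zero_pow (by omega), mul_zero]
    rw [hasDerivAt_iff_isLittleO]
    simp only [max_self, sub_zero, smul_zero]
    rw [zero_pow (by omega)]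
    simp only [sub_zero]
    have : (fun t : ℝ => max t 0 ^ (k + 2)) =O[𝓝 0] fun t => t ^ (k + 2) := by
      refine Asymptotics.IsBigO.of_bound 1 (Filter.Eventually.of_forall fun t => ?_)
      rw [one_mul, norm_pow, norm_pow]
      gcongr
      rw [Real.norm_eq_abs, Real.norm_eq_abs, abs_of_nonneg (le_max_right t 0)]
      exact max_le (le_abs_self t) (abs_nonneg t)
    refine this.trans_isLittleO ?_
    simpa using Asymptotics.isLittleO_pow_id (𝕜 := ℝ) (n := k + 2) (by omega)
  · have he : (fun t : ℝ => max t 0 ^ (k + 2)) =ᶠ[𝓝 x] fun t => t ^ (k + 2) := by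
      filter_upwards [Ioi_mem_nhds h] with t ht
      rw [max_eq_left (le_of_lt ht)]
    rw [max_eq_left h.le]
    have := (hasDerivAt_pow (k + 2) x).congr_of_eventuallyEq he
    simpa using this

theorem contDiff_max_pow (r : ℕ) : ContDiff ℝ r (fun t : ℝ => max t 0 ^ (r + 1)) := by
  induction r with
  | zero =>
    refine contDiff_zero.2 ?_
    fun_prop
  | succ k ih =>
    push_cast
    rw [contDiff_succ_iff_deriv]
    refine ⟨fun x => (hasDerivAt_max_pow k x).differentiableAt, by simp, ?_⟩
    rw [show deriv (fun t : ℝ => max t 0 ^ (k + 1 + 1)) = fun t : ℝ => (k + 2) * max t 0 ^ (k + 1) from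
      funext fun x => (hasDerivAt_max_pow k x).deriv]
    exact contDiff_const.mul ih

/-- A definable `C^r` function equal to `1` on `t ≤ 1/4` and to `0` on `t ≥ 1/2`. -/
theorem exists_bump [OMin L] (r : ℕ) : ∃ θ : ℝ → ℝ, DF L θ ∧ ContDiff ℝ r θ ∧
    (∀ t, 0 ≤ θ t ∧ θ t ≤ 1) ∧ (∀ t ≤ 1 / 4, θ t = 1) ∧ ∀ t, 1 / 2 ≤ t → θ t = 0 := by
  let p : ℝ → ℝ := fun t => max t 0 ^ (r + 1)
  have hp0 : ∀ t, 0 ≤ p t := fun t => by positivity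
  have hpz : ∀ t ≤ 0, p t = 0 := fun t ht => by simp [p, ht]
  have hpp : ∀ t, 0 < t → 0 < p t := fun t ht => by
    have : 0 < max t 0 := lt_max_of_lt_left ht
    positivity
  have hpos : ∀ t : ℝ, 0 < p (1 / 2 - t) + p (t - 1 / 4) := fun t => by
    rcases lt_or_ge t (1 / 2) with h | h
    · exact add_pos_of_pos_of_nonneg (hpp _ (by linarith)) (hp0 _)
    · exact add_pos_of_nonneg_of_pos (hp0 _) (hpp _ (by linarith))
  have hpd : DF L p := by
    change DF L (fun t : ℝ => max t 0 ^ (r + 1))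
    fun_prop
  have hc : ContDiff ℝ r p := contDiff_max_pow r
  refine ⟨fun t => p (1 / 2 - t) / (p (1 / 2 - t) + p (t - 1 / 4)), by fun_prop, ?_, ?_, ?_, ?_⟩
  · exact ContDiff.div (by fun_prop) (by fun_prop) fun t => (hpos t).ne'
  · intro t
    refine ⟨div_nonneg (hp0 _) (hpos t).le, (div_le_one (hpos t)).2 ?_⟩
    linarith [hp0 (t - 1 / 4)]
  · intro t ht
    have h := hpos t
    beta_reduce
    rw [hpz (t - 1 / 4) (by linarith)] at h ⊢
    rw [add_zero] at h ⊢
    exact div_self h.ne'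
  · intro t ht
    beta_reduce
    rw [hpz (1 / 2 - t) (by linarith), zero_div]

/-! ### Local interpolation in the target -/

section Interpolation

variable {β : Type} [Fintype β]

/-- The set `Y` is everywhere a `C^r` graph over some of the coordinates. -/
def LocallyGraph (r : ℕ) (Y : Set (β → ℝ)) : Prop := ∀ y ∈ Y, ∃ T H, LocGraph r Y T y H

/-- A local interpolation on `Y`: the curve `t ↦ G (y₀, y₁, t)` leads from `y₁` to `y₀` in `Y`
and is defined when the points `y₀` and `y₁` of `Y` are close. It is `C^r` on the members of a
partition `Yp` of `Y`. -/
structure Interpolation (L : FirstOrder.Language) [L.Structure ℝ] (r : ℕ) (Y : Set (β → ℝ))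
    (Yp : Finset β → Set (β → ℝ)) (Ω : Set ((β → ℝ) × (β → ℝ) × ℝ))
    (G : (β → ℝ) × (β → ℝ) × ℝ → β → ℝ) : Prop where
  part : ∀ i, DS L (Yp i)
  dom : DS L Ω
  map : DF L G
  cover : ∀ y ∈ Y, ∃ i, y ∈ Yp i
  mem : ∀ p ∈ Ω, G p ∈ Y
  zero : ∀ y₀ y₁, (y₀, y₁, (0 : ℝ)) ∈ Ω → G (y₀, y₁, 0) = y₁
  one : ∀ y₀ y₁, (y₀, y₁, (1 : ℝ)) ∈ Ω → G (y₀, y₁, 1) = y₀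
  smooth : ∀ i, ∀ p ∈ Ω, p.1 ∈ Yp i →
    ∃ K, ContDiffAt ℝ r K p ∧ ∀ᶠ q in 𝓝 p, q.1 ∈ Yp i → G q = K q
  diag : ∀ i, ∀ y ∈ Yp i, ∀ U ∈ 𝓝 y, ∀ᶠ p in 𝓝 (y, y), p.1 ∈ Yp i → p.2 ∈ Y →
    ∀ t : ℝ, 0 ≤ t → t ≤ 1 → (p.1, p.2, t) ∈ Ω ∧ G (p.1, p.2, t) ∈ U

/-- The point dividing the segment from `p.2.1` to `p.1` in the ratio given by `p.2.2`. -/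
def segPoint (p : (β → ℝ) × (β → ℝ) × ℝ) : β → ℝ :=
  fun i => (1 - p.2.2) * p.2.1 i + p.2.2 * p.1 i

theorem DF.segPoint [OMin L] : DF L (segPoint (β := β)) := by
  unfold Paper.segPoint
  fun_prop

theorem contDiff_segPoint (r : ℕ) : ContDiff ℝ r (segPoint (β := β)) := by
  unfold segPoint
  fun_prop

theorem dist_segPoint_lt {y y₀ y₁ : β → ℝ} {t ρ : ℝ} (h0 : dist y₀ y < ρ) (h1 : dist y₁ y < ρ)
    (ht0 : 0 ≤ t) (ht1 : t ≤ 1) : dist (segPoint (y₀, y₁, t)) y < ρ := by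
  have := (convex_ball y ρ) (show y₁ ∈ Metric.ball y ρ from h1) (show y₀ ∈ Metric.ball y ρ from h0)
    (sub_nonneg.2 ht1) ht0 (by ring)
  exact this

theorem exists_interpolation [OMin L] {r : ℕ} {Y : Set (β → ℝ)} (hY : DS L Y)
    (hloc : LocallyGraph r Y) : ∃ Yp Ω G, Interpolation L r Y Yp Ω G := by
  classical
  let Yt : Finset β → Set (β → ℝ) := fun T =>
    Spec r Y T (fun y => y) (fun _ : Empty => (∅ : Set (β → ℝ)))
  have hYt : ∀ T, DS L (Yt T) := fun T => DS.spec hY (by fun_prop) (fun i => i.elim)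
  have hYtg : ∀ T, ∀ y ∈ Yt T, ∃ H, LocGraph r Y T y H := fun T y hy => ⟨_, hy.1.choose_spec.1⟩
  have hYtm : ∀ T y H, LocGraph r Y T y H → y ∈ Yt T :=
    fun T y H h => ⟨⟨H, h, h.smooth⟩, fun i => i.elim⟩
  let e := Fintype.equivFin (Finset β)
  let Yp : Finset β → Set (β → ℝ) := fun T => {y | y ∈ Yt T ∧ ∀ T', e T' < e T → y ∉ Yt T'}
  have hYp : ∀ T, DS L (Yp T) := fun T => by
    refine DP.and (hYt T) (DP.finite_all fun T' => ?_)
    by_cases h : e T' < e T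
    · simpa only [h, forall_const] using (hYt T').not
    · simpa only [h, false_imp_iff] using DP.const True
  have huniq : ∀ T T' y, y ∈ Yp T → y ∈ Yp T' → T = T' := by
    intro T T' y h h'
    rcases lt_trichotomy (e T) (e T') with hlt | heq | hgt
    · exact absurd h.1 (h'.2 _ hlt)
    · exact e.injective heq
    · exact absurd h'.1 (h.2 _ hgt)
  have hcover : ∀ y ∈ Y, ∃ i, y ∈ Yp i := by
    intro y hy
    obtain ⟨T, H, hT⟩ := hloc y hy
    obtain ⟨T, hT, hmin⟩ := Finset.exists_min_image (Finset.univ.filter fun T => y ∈ Yt T) e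
      ⟨T, by simpa using hYtm T y H hT⟩
    refine ⟨T, by simpa using hT, fun T' hlt hT' => ?_⟩
    exact absurd (hmin T' (by simpa using hT')) (not_le.2 hlt)
  have hrad : ∀ T : Finset β, ∃ R : (β → ℝ) → ℝ, DF L R ∧ Continuous R ∧
      (∀ s ∈ Yt T, 0 < R s) ∧ ∀ s w w', dist w s < R s → dist w' s < R s →
        (w ∈ Y → w ∈ Yt T) ∧ (w ∈ Y → w' ∈ Y → res T w = res T w' → w = w') := by
    intro T
    have hA : DP L (fun p : (β → ℝ) × (β → ℝ) => (p.1 ∈ Y → p.1 ∈ Yt T) ∧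
        (p.1 ∈ Y → p.2 ∈ Y → res T p.1 = res T p.2 → p.1 = p.2)) := by
      have := hYt T
      simp only [imp_iff_not_or]
      fun_prop
    obtain ⟨R, h1, h2, -, h3, h4⟩ := exists_radius hA
    refine ⟨R, h1, h2, fun s hs => h3 s ?_, h4⟩
    obtain ⟨H, h⟩ := hYtg T s hs
    have hev := Spec.eventually hs
    have hm := h.mem
    rw [nhds_prod_eq]
    filter_upwards [hev.prod_mk hev, hm.prod_mk hm] with p hp1 hp2
    refine ⟨hp1.1, fun hw hw' heq => ?_⟩
    rw [← hp2.1.1 hw, ← hp2.2.1 hw', heq]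
  choose R hRd hRc hRpos hR using hrad
  let P : (β → ℝ) × (β → ℝ) × ℝ → (β → ℝ) → Prop := fun p y =>
    ∃ T, p.1 ∈ Yp T ∧ y ∈ Y ∧ dist y p.1 < R T p.1 ∧ res T y = res T (segPoint p)
  have hPd : DP L (fun q : ((β → ℝ) × (β → ℝ) × ℝ) × (β → ℝ) => P q.1 q.2) := by
    refine DP.finite_ex fun T => ?_
    have h1 := hYp T
    have h2 := hRd T
    have h3 : DF L (segPoint (β := β)) := DF.segPoint
    fun_prop
  have hPu : ∀ p y y', P p y → P p y' → y' = y := by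
    rintro p y y' ⟨T, h1, h2, h3, h4⟩ ⟨T', h1', h2', h3', h4'⟩
    obtain rfl := huniq T T' _ h1 h1'
    exact ((hR T p.1 y y' h3 h3').2 h2 h2' (h4.trans h4'.symm)).symm
  let G : (β → ℝ) × (β → ℝ) × ℝ → β → ℝ := fun p => the (P p)
  have hG : ∀ p y, P p y → G p = y := fun p y h => the_eq h fun z hz => hPu p y z h hz
  let Ω : Set ((β → ℝ) × (β → ℝ) × ℝ) := {p | (p.1 ∈ Y ∧ p.2.1 ∈ Y) ∧
    (∃ T, p.1 ∈ Yp T ∧ dist p.2.1 p.1 < R T p.1) ∧ ∃ y, P p y}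
  refine ⟨Yp, Ω, G, ⟨hYp, ?_, DF.the hPd, hcover, ?_, ?_, ?_, ?_, ?_⟩⟩
  · refine DP.and (by fun_prop) (DP.and (DP.finite_ex fun T => ?_) (DP.ex hPd))
    have h1 := hYp T
    have h2 := hRd T
    fun_prop
  · rintro p ⟨-, -, y, hy⟩
    rw [hG p y hy]
    exact hy.choose_spec.2.1
  · rintro y₀ y₁ ⟨⟨-, hy1⟩, ⟨T, hT, hd⟩, -⟩
    refine hG _ _ ⟨T, hT, hy1, hd, ?_⟩
    congr 1
    ext i
    simp [segPoint]
  · rintro y₀ y₁ ⟨⟨hy0, -⟩, ⟨T, hT, hd⟩, -⟩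
    refine hG _ _ ⟨T, hT, hy0, by simpa using hRpos T y₀ hT.1, ?_⟩
    congr 1
    ext i
    simp [segPoint]
  · rintro T p ⟨-, -, y, hy⟩ hpT
    have hy' := hy
    obtain ⟨T', hT', h1, h2, h3⟩ := hy'
    obtain rfl := huniq T T' _ hpT hT'
    obtain ⟨H, hH⟩ := hYtg T y ((hR T p.1 y y h2 h2).1 h1)
    have hs : ContDiffAt ℝ r (fun q => H (res T (segPoint q))) p := by
      have h4 : ContDiffAt ℝ r (fun q : (β → ℝ) × (β → ℝ) × ℝ => res T (segPoint q)) p :=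
        ((contDiff_res T r).comp (contDiff_segPoint r)).contDiffAt
      exact ContDiffAt.comp p (h3 ▸ hH.smooth) h4
    have ht : Filter.Tendsto (fun q : (β → ℝ) × (β → ℝ) × ℝ => res T (segPoint q)) (𝓝 p)
        (𝓝 (res T y)) := by
      rw [h3]
      exact ((contDiff_res T r).comp (contDiff_segPoint r)).continuous.tendsto p
    refine ⟨_, hs, ?_⟩
    have hd : ∀ᶠ q in 𝓝 p, dist (H (res T (segPoint q))) q.1 < R T q.1 := by
      have hc : ContinuousAt (fun q => dist (H (res T (segPoint q))) q.1 - R T q.1) p := by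
        exact (hs.continuousAt.dist continuousAt_fst).sub
          ((hRc T).continuousAt.comp continuousAt_fst)
      have hlt : dist (H (res T (segPoint p))) p.1 - R T p.1 < 0 := by
        rw [← h3, hH.base]
        linarith
      exact (hc.eventually_lt continuousAt_const hlt).mono fun q hq => by linarith
    filter_upwards [hd, ht.eventually hH.proj, ht.eventually hH.eventually_mem] with q a1 a2 a3 hq
    exact hG _ _ ⟨T, hq, a3, a1, a2⟩
  · intro T y hy U hU
    obtain ⟨H, hH⟩ := hYtg T y hy.1
    have hpos := hRpos T y hy.1
    have hV : ∀ᶠ z in 𝓝 y, dist z y < R T y / 4 := Metric.ball_mem_nhds y (by linarith)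
    have hRe : ∀ᶠ z in 𝓝 y, R T y / 2 < R T z :=
      (hRc T).continuousAt.eventually (lt_mem_nhds (by linarith))
    have hgood : ∀ᶠ v in 𝓝 y, H (res T v) ∈ U ∧ dist (H (res T v)) y < R T y / 4 ∧
        H (res T v) ∈ Y ∧ res T (H (res T v)) = res T v := by
      have ht : Filter.Tendsto (res T) (𝓝 y) (𝓝 (res T y)) := (continuous_res T).continuousAt
      filter_upwards [ht.eventually (hH.tendsto.eventually hU),
        ht.eventually (hH.tendsto.eventually hV), ht.eventually hH.eventually_mem,
        ht.eventually hH.proj] with v h1 h2 h3 h4 using ⟨h1, h2, h3, h4⟩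
    obtain ⟨ρ, hρ, hb⟩ := Metric.eventually_nhds_iff.1 hgood
    have hball : ∀ᶠ z in 𝓝 y, dist z y < ρ := Metric.ball_mem_nhds y hρ
    rw [nhds_prod_eq]
    filter_upwards [(hball.and (hV.and hRe)).prod_mk (hball.and hV)]
      with p hp hp1 hp2 t ht0 ht1
    obtain ⟨⟨b1, b2, b3⟩, b4, b5⟩ := hp
    obtain ⟨g1, g2, g3, g4⟩ := hb (dist_segPoint_lt b1 b4 ht0 ht1)
    have hPp : P (p.1, p.2, t) (H (res T (segPoint (p.1, p.2, t)))) :=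
      ⟨T, hp1, g3, by linarith [dist_triangle_right (H (res T (segPoint (p.1, p.2, t)))) p.1 y], g4⟩
    refine ⟨⟨⟨Spec.subset hp1.1, hp2⟩, ⟨T, hp1, ?_⟩, _, hPp⟩, ?_⟩
    · change dist p.2 p.1 < R T p.1
      linarith [dist_triangle_right p.2 p.1 y]
    · rw [hG _ _ hPp]
      exact g1

end Interpolation

/-! ### Tubes around local graphs -/

section Tube

variable {α : Type} [Fintype α]

/-- The square of the Euclidean distance. -/
def sqDist (z s : α → ℝ) : ℝ := ∑ i, (z i - s i) ^ 2

@[fun_prop]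
theorem DF.sqDist [OMin L] {E : Type} [TopologicalSpace E] [Coord E] {f g : E → α → ℝ}
    (hf : DF L f) (hg : DF L g) : DF L (fun x => sqDist (f x) (g x)) := by
  unfold Paper.sqDist
  fun_prop

theorem contDiff_sqDist (r : ℕ) :
    ContDiff ℝ r (fun p : (α → ℝ) × (α → ℝ) => sqDist p.1 p.2) := by
  unfold sqDist
  fun_prop

theorem sqDist_self (s : α → ℝ) : sqDist s s = 0 := by simp [sqDist]

theorem dist_lt_of_sqDist_lt {z s : α → ℝ} {d : ℝ} (hd : 0 < d) (h : sqDist z s < d ^ 2) :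
    dist z s < d := by
  refine (dist_pi_lt_iff hd).2 fun i => ?_
  rw [Real.dist_eq]
  refine abs_lt_of_sq_lt_sq (lt_of_le_of_lt ?_ h) hd.le
  exact Finset.single_le_sum (f := fun i => (z i - s i) ^ 2) (fun i _ => sq_nonneg _)
    (Finset.mem_univ i)

/-- A tube `N` around a local graph `S`, with its projection `π` onto `S` along the coordinates in
`T` and a cut-off function `φ`. -/
structure IsTube (L : FirstOrder.Language) [L.Structure ℝ] (r : ℕ) (S : Set (α → ℝ))
    (T : Finset α) (R : (α → ℝ) → ℝ) (N : Set (α → ℝ)) (π : (α → ℝ) → α → ℝ)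
    (φ : (α → ℝ) → ℝ) : Prop where
  dom : DS L N
  proj : DF L π
  cut : DF L φ
  cut_nonneg : ∀ z, 0 ≤ φ z
  cut_le_one : ∀ z, φ z ≤ 1
  proj_mem : ∀ z ∈ N, π z ∈ S
  dist_lt : ∀ z ∈ N, dist z (π z) < R (π z)
  res_eq : ∀ z ∈ N, res T (π z) = res T z
  proj_eq : ∀ z ∈ N, ∀ H, LocGraph r S T (π z) H → ∀ᶠ w in 𝓝 z, w ∈ N ∧ π w = H (res T w)
  smooth : ∀ z ∈ N, ContDiffAt ℝ r φ z
  subset : S ⊆ N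
  cut_one : ∀ z ∈ S, ∀ᶠ w in 𝓝 z, φ w = 1
  cut_zero : ∀ z ∉ N, z ∉ closure S → ∀ᶠ w in 𝓝 z, w ∈ N → φ w = 0

theorem exists_tube [OMin L] {r : ℕ} {S : Set (α → ℝ)} {T : Finset α} {R δ : (α → ℝ) → ℝ}
    (hS : DS L S) (hSg : ∀ s ∈ S, ∃ H, LocGraph r S T s H) (hRc : Continuous R)
    (hR0 : ∀ s, 0 ≤ R s) (hR1 : ∀ s, R s ≤ 1)
    (hRcl : ∀ s w, dist w s < R s → w ∈ closure S → w ∈ S)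
    (hRinj : ∀ s w w', dist w s < R s → dist w' s < R s → w ∈ S → w' ∈ S → res T w = res T w' →
      w = w')
    (hδ : DF L δ) (hδs : ∀ s ∈ S, CrAt r S δ s) (hδ0 : ∀ s ∈ S, 0 < δ s)
    (hδR : ∀ s ∈ S, 2 * δ s < R s) : ∃ N π φ, IsTube L r S T R N π φ := by
  obtain ⟨θ, hθd, hθs, hθ, hθ1, hθ0⟩ := exists_bump (L := L) r
  let I : (α → ℝ) → (α → ℝ) → Prop := fun z s =>
    s ∈ S ∧ res T s = res T z ∧ sqDist z s < δ s ^ 2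
  have hId : DP L (fun p : (α → ℝ) × (α → ℝ) => I p.1 p.2) := by
    change DP L (fun p : (α → ℝ) × (α → ℝ) =>
      p.2 ∈ S ∧ res T p.2 = res T p.1 ∧ sqDist p.1 p.2 < δ p.2 ^ 2)
    fun_prop
  have hdist : ∀ z s, I z s → dist z s < δ s := fun z s h =>
    dist_lt_of_sqDist_lt (hδ0 s h.1) h.2.2
  have hI_le : ∀ z s s', I z s → I z s' → R s' ≤ R s → s = s' := by
    intro z s s' h h' hle
    have h1 := hdist z s h
    have h2 := hdist z s' h'
    have h3 := hδR s h.1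
    have h4 := hδR s' h'.1
    have h5 := dist_triangle_left s' s z
    refine hRinj s s s' ?_ (by linarith) h.1 h'.1 (h.2.1.trans h'.2.1.symm)
    rw [dist_self]
    linarith [hδ0 s h.1]
  have hIu : ∀ z s s', I z s → I z s' → s' = s := fun z s s' h h' =>
    (le_total (R s') (R s)).elim (fun hle => (hI_le z s s' h h' hle).symm)
      (fun hle => hI_le z s' s h' h hle)
  let N : Set (α → ℝ) := {z | ∃ s, I z s}
  let π : (α → ℝ) → α → ℝ := fun z => the (I z)
  have hπ : ∀ z s, I z s → π z = s := fun z s h => the_eq h fun s' h' => hIu z s s' h h'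
  have hπd : DF L π := DF.the hId
  have hNI : ∀ z ∈ N, I z (π z) := fun z ⟨s, hs⟩ => by rwa [hπ z s hs]
  have hself : ∀ z ∈ S, I z z := fun z hz => ⟨hz, rfl, by
    rw [sqDist_self]
    have := hδ0 z hz
    positivity⟩
  have hlocal : ∀ z ∈ N, ∀ H, LocGraph r S T (π z) H →
      ∃ u : (α → ℝ) → ℝ, ContDiffAt ℝ r u z ∧
        u z = sqDist z (π z) / δ (π z) ^ 2 ∧ ∀ᶠ w in 𝓝 z, (w ∈ N ∧ π w = H (res T w)) ∧
          sqDist w (π w) / δ (π w) ^ 2 = u w := by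
    intro z hz H hH
    obtain ⟨d, hd, hdδ⟩ := hδs (π z) (hNI z hz).1
    have hres := (hNI z hz).2.1
    have hzero : δ (π z) = d (π z) := CrAt.eq_of_mem hdδ (hNI z hz).1
    have hdpos : 0 < d (π z) := hzero ▸ hδ0 _ (hNI z hz).1
    have ht : Filter.Tendsto (res T) (𝓝 z) (𝓝 (res T (π z))) :=
      hres ▸ (continuous_res T).continuousAt
    have hbase : H (res T z) = π z := by rw [← hres, hH.base]
    have h1 : ContDiffAt ℝ r (fun w => H (res T w)) z :=
      ContDiffAt.comp z (hres ▸ hH.smooth) (contDiff_res T r).contDiffAt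
    have h2 : ContDiffAt ℝ r (fun w => d (H (res T w))) z :=
      ContDiffAt.comp z (hbase ▸ hd) h1
    have h3 : ContDiffAt ℝ r (fun w => sqDist w (H (res T w))) z :=
      (contDiff_sqDist r).contDiffAt.comp z (contDiffAt_id.prodMk h1)
    have hne : d (H (res T z)) ^ 2 ≠ 0 := by
      rw [hbase]
      positivity
    have hlt : sqDist z (H (res T z)) < d (H (res T z)) ^ 2 := by
      rw [hbase, ← hzero]
      exact (hNI z hz).2.2
    refine ⟨fun w => sqDist w (H (res T w)) / d (H (res T w)) ^ 2, h3.div (h2.pow 2) hne, ?_, ?_⟩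
    · simp only [hbase, hzero]
    · have hev := (h3.continuousAt.eventually_lt (h2.continuousAt.pow 2) hlt)
      rw [eventually_nhdsWithin_iff] at hdδ
      filter_upwards [hev, ht.eventually hH.proj, ht.eventually hH.eventually_mem,
        ht.eventually (hH.tendsto.eventually hdδ)] with w w1 w2 w3 w4
      have hI : I w (H (res T w)) := ⟨w3, w2, by rwa [w4 w3]⟩
      have hw := hπ w _ hI
      exact ⟨⟨⟨_, hI⟩, hw⟩, by rw [hw, w4 w3]⟩
  refine ⟨N, π, fun z => θ (sqDist z (π z) / δ (π z) ^ 2), ⟨DP.ex hId, hπd, by fun_prop,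
    fun z => (hθ _).1, fun z => (hθ _).2, fun z hz => (hNI z hz).1, ?_, fun z hz => (hNI z hz).2.1,
    ?_, ?_, fun z hz => ⟨z, hself z hz⟩, ?_, ?_⟩⟩
  · intro z hz
    have h := hNI z hz
    linarith [hdist z _ h, hδR _ h.1, hδ0 _ h.1]
  · intro z hz H hH
    obtain ⟨u, -, -, h⟩ := hlocal z hz H hH
    exact h.mono fun w hw => hw.1
  · intro z hz
    obtain ⟨H, hH⟩ := hSg _ (hNI z hz).1
    obtain ⟨u, hu, -, h⟩ := hlocal z hz H hH
    exact (hθs.contDiffAt.comp z hu).congr_of_eventuallyEq (h.mono fun w hw => congrArg θ hw.2)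
  · intro z hz
    obtain ⟨H, hH⟩ := hSg _ hz
    have hzz : π z = z := hπ z z (hself z hz)
    obtain ⟨u, hu, huz, h⟩ := hlocal z ⟨z, hself z hz⟩ H (by rwa [hzz])
    have : u z < 1 / 4 := by
      rw [huz, hzz, sqDist_self, zero_div]
      norm_num
    filter_upwards [h, hu.continuousAt.eventually (gt_mem_nhds this)] with w h1 h2
    rw [h1.2]
    exact hθ1 _ h2.le
  · intro a haN haS
    by_contra hcon
    obtain ⟨u, hu, hu'⟩ := Filter.exists_seq_forall_of_frequently (Filter.not_eventually.1 hcon)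
    simp only [Classical.not_imp] at hu'
    have hI : ∀ n, I (u n) (π (u n)) := fun n => hNI _ (hu' n).1
    have hd : ∀ n, dist (u n) (π (u n)) < δ (π (u n)) := fun n => hdist _ _ (hI n)
    have hdR : ∀ n, dist (u n) (π (u n)) ≤ R (π (u n)) / 2 := fun n => by
      linarith [hd n, hδR _ (hI n).1]
    have hq : ∀ n, sqDist (u n) (π (u n)) ≤ δ (π (u n)) ^ 2 / 2 := fun n => by
      have hpos := hδ0 _ (hI n).1
      have h1 : ¬ 1 / 2 ≤ sqDist (u n) (π (u n)) / δ (π (u n)) ^ 2 := fun h =>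
        (hu' n).2 (hθ0 _ h)
      rw [not_le, div_lt_iff₀ (by positivity)] at h1
      linarith
    have hbdd : ∀ᶠ n in Filter.atTop, π (u n) ∈ Metric.closedBall a 2 := by
      filter_upwards [hu.eventually (Metric.ball_mem_nhds a one_pos)] with n hn
      rw [Metric.mem_closedBall]
      have hn : dist (u n) a < 1 := hn
      linarith [dist_triangle_left (π (u n)) a (u n), hdR n, hR1 (π (u n))]
    obtain ⟨b, -, ψ, hψ, hb⟩ := (isCompact_closedBall a 2).tendsto_subseq' hbdd.frequently
    have hua : Filter.Tendsto (fun n => u (ψ n)) Filter.atTop (𝓝 a) := hu.comp hψ.tendsto_atTop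
    have hb : Filter.Tendsto (fun n => π (u (ψ n))) Filter.atTop (𝓝 b) := hb
    have hbS : b ∈ closure S :=
      mem_closure_of_tendsto hb (Filter.Eventually.of_forall fun n => (hI (ψ n)).1)
    have hab : dist a b ≤ R b / 2 :=
      le_of_tendsto_of_tendsto' (hua.dist hb) (((hRc.tendsto b).comp hb).div_const 2)
        fun n => hdR (ψ n)
    rcases (hR0 b).eq_or_lt with h0 | h0
    · have : a = b := dist_le_zero.1 (by linarith)
      exact haS (this ▸ hbS)
    · have hbS' : b ∈ S := hRcl b b (by rwa [dist_self]) hbS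
      have hδb : Filter.Tendsto (fun n => δ (π (u (ψ n)))) Filter.atTop (𝓝 (δ b)) :=
        ((hδs b hbS').continuousWithinAt hbS').tendsto.comp
          (tendsto_nhdsWithin_iff.2 ⟨hb, Filter.Eventually.of_forall fun n => (hI (ψ n)).1⟩)
      refine haN ⟨b, hbS', ?_, ?_⟩
      · exact tendsto_nhds_unique (((continuous_res T).tendsto b).comp hb)
          ((((continuous_res T).tendsto a).comp hua).congr fun n => (hI (ψ n)).2.1.symm)
      · have h1 : sqDist a b ≤ δ b ^ 2 / 2 :=
          le_of_tendsto_of_tendsto'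
            (((contDiff_sqDist 0).continuous.tendsto (a, b)).comp (hua.prodMk_nhds hb))
            ((hδb.pow 2).div_const 2) fun n => hq (ψ n)
        have := hδ0 b hbS'
        have : 0 < δ b ^ 2 := by positivity
        linarith

end Tube

/-! ### Smoothing near one stratum -/

section Smoothing

variable {α β : Type} [Fintype α] [Fintype β]

theorem DS.closure [OMin L] {S : Set (α → ℝ)} (hS : DS L S) : DS L (closure S) := by
  have : DP L (fun w : α → ℝ => ¬ ∀ᶠ v in 𝓝 w, v ∉ S) := by fun_prop
  refine this.congr fun w => ?_
  rw [mem_closure_iff_frequently]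
  rfl

theorem exists_step_radius [OMin L] {r : ℕ} {X Z : Set (α → ℝ)} {T : Finset α}
    {f : (α → ℝ) → β → ℝ} {Y : Set (β → ℝ)} {Yp : Finset β → Set (β → ℝ)}
    {Ω : Set ((β → ℝ) × (β → ℝ) × ℝ)} {G : (β → ℝ) × (β → ℝ) × ℝ → β → ℝ}
    {η : (α → ℝ) → ℝ} (hY : Interpolation L r Y Yp Ω G) (hX : DS L X) (hZ : DS L Z) (hZX : Z ⊆ X)
    (hf : DF L f) (hfc : ContinuousOn f X) (hfY : MapsTo f X Y) (hη : DF L η)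
    (hηc : ContinuousOn η X) (hη0 : ∀ s ∈ Spec r Z T f Yp, 0 < η s) :
    ∃ R : (α → ℝ) → ℝ, DF L R ∧ Continuous R ∧ (∀ s, 0 ≤ R s) ∧ (∀ s, R s ≤ 1) ∧
      (∀ s ∈ Spec r Z T f Yp, 0 < R s) ∧
      (∀ s w, dist w s < R s → w ∈ closure (Spec r Z T f Yp) → w ∈ Spec r Z T f Yp) ∧
      (∀ s w w', dist w s < R s → dist w' s < R s → w ∈ Spec r Z T f Yp → w' ∈ Spec r Z T f Yp →
        res T w = res T w' → w = w') ∧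
      ∀ s w, s ∈ Spec r Z T f Yp → w ∈ X → dist w s < R s → ∀ t : ℝ, 0 ≤ t → t ≤ 1 →
        (f s, f w, t) ∈ Ω ∧ dist (G (f s, f w, t)) (f w) < η w := by
  have hS : DS L (Spec r Z T f Yp) := DS.spec hZ hf hY.part
  have hSg := fun s hs => Spec.locGraph (s := s) (r := r) (Z := Z) (T := T) (f := f) (Yp := Yp) hs
  have hSp : ∀ s ∈ Spec r Z T f Yp, ∀ i, ∀ᶠ w in 𝓝 s, w ∈ Spec r Z T f Yp → f s ∈ Yp i →
      f w ∈ Yp i := fun s hs i =>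
    (hs.2 i).mono fun w hw hwS hsi => (hw (Spec.subset hwS)).2 hsi
  have hSX : Spec r Z T f Yp ⊆ X := Spec.subset.trans hZX
  generalize Spec r Z T f Yp = S at *
  have hA : DP L (fun p : (α → ℝ) × (α → ℝ) => (p.1 ∈ closure S → p.1 ∈ S) ∧
      (p.1 ∈ S → p.2 ∈ S → res T p.1 = res T p.2 → p.1 = p.2) ∧
      (p.1 ∈ S → p.2 ∈ X → ∀ t : ℝ, 0 ≤ t → t ≤ 1 →
        (f p.1, f p.2, t) ∈ Ω ∧ dist (G (f p.1, f p.2, t)) (f p.2) < η p.2)) := by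
    have h1 := hS.closure
    have h2 := hY.dom
    have h3 := hY.map
    simp only [imp_iff_not_or]
    fun_prop
  obtain ⟨R, hRd, hRc, hR01, hRpos, hR⟩ := exists_radius hA
  refine ⟨R, hRd, hRc, fun s => (hR01 s).1, fun s => (hR01 s).2, fun s hs => hRpos s ?_,
    fun s w hw => (hR s w w hw hw).1, fun s w w' hw hw' => (hR s w w' hw hw').2.1,
    fun s w hs hw hd => (hR s s w (by rw [dist_self]; exact dist_nonneg.trans_lt hd) hd).2.2 hs hw⟩
  obtain ⟨H, hH, -⟩ := hSg s hs
  obtain ⟨i, hi⟩ := hY.cover _ (hfY (hSX hs))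
  have hpos := hη0 s hs
  have hfs : Filter.Tendsto f (𝓝[X] s) (𝓝 (f s)) := hfc s (hSX hs)
  have hηs : Filter.Tendsto η (𝓝[X] s) (𝓝 (η s)) := hηc s (hSX hs)
  have hdiag := hY.diag i (f s) hi _ (Metric.ball_mem_nhds (f s) (show 0 < η s / 4 by linarith))
  rw [nhds_prod_eq] at hdiag
  obtain ⟨V, hV, V', hV', hVV⟩ := Filter.mem_prod_iff.1 hdiag
  have e1 : ∀ᶠ w in 𝓝 s, w ∈ X → f w ∈ V := eventually_nhdsWithin_iff.1 (hfs.eventually hV)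
  have e2 : ∀ᶠ w in 𝓝 s, w ∈ X → f w ∈ V' := eventually_nhdsWithin_iff.1 (hfs.eventually hV')
  have e3 : ∀ᶠ w in 𝓝 s, w ∈ X → dist (f w) (f s) < η s / 4 := eventually_nhdsWithin_iff.1
    (hfs.eventually (Metric.ball_mem_nhds (f s) (show 0 < η s / 4 by linarith)))
  have e4 : ∀ᶠ w in 𝓝 s, w ∈ X → η s / 2 < η w := eventually_nhdsWithin_iff.1
    (hηs.eventually (lt_mem_nhds (by linarith)))
  rw [nhds_prod_eq]
  filter_upwards [(hH.closed.and (hH.mem.and ((hSp s hs i).and e1))).prod_mk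
    (hH.mem.and (e2.and (e3.and e4)))] with p hp
  obtain ⟨⟨p1, p2, p3, p4⟩, q1, q2, q3, q4⟩ := hp
  refine ⟨p1, fun hw hw' heq => ?_, fun hw hw' t ht0 ht1 => ?_⟩
  · rw [← p2.1 hw, ← q1.1 hw', heq]
  · obtain ⟨g1, g2⟩ := hVV (Set.mk_mem_prod (p4 (hSX hw)) (q2 hw')) (p3 hw hi) (hfY hw') t ht0 ht1
    refine ⟨g1, ?_⟩
    have g2 : dist (G (f p.1, f p.2, t)) (f s) < η s / 4 := g2
    linarith [dist_triangle_right (G (f p.1, f p.2, t)) (f p.2) (f s), q3 hw', q4 hw']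

theorem exists_smoothing_step [OMin L] {r : ℕ} {X Z : Set (α → ℝ)} {T : Finset α}
    {f : (α → ℝ) → β → ℝ} {Y : Set (β → ℝ)} {Yp : Finset β → Set (β → ℝ)}
    {Ω : Set ((β → ℝ) × (β → ℝ) × ℝ)} {G : (β → ℝ) × (β → ℝ) × ℝ → β → ℝ}
    {ε : (α → ℝ) → ℝ} (hY : Interpolation L r Y Yp Ω G) (hX : DS L X) (hZ : DS L Z) (hZX : Z ⊆ X)
    (hZc : ∀ a ∈ X, a ∉ Z → ∀ᶠ z in 𝓝 a, z ∉ Z)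
    (hf : DF L f) (hfc : ContinuousOn f X) (hfY : MapsTo f X Y)
    (hfs : ∀ a ∈ X, a ∉ Z → CrAt r X f a) (hε : DF L ε)
    (hεc : ContinuousOn ε X) (hε0 : ∀ x ∈ X, 0 < ε x)
    (hδ : ∀ R : (α → ℝ) → ℝ, DF L R → Continuous R → (∀ s ∈ Spec r Z T f Yp, 0 < R s) →
      ∃ δ : (α → ℝ) → ℝ, DF L δ ∧ ∀ s ∈ Spec r Z T f Yp,
        CrAt r (Spec r Z T f Yp) δ s ∧ 0 < δ s ∧ 2 * δ s < R s) :
    ∃ g : (α → ℝ) → β → ℝ, DF L g ∧ ContinuousOn g X ∧ MapsTo g X Y ∧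
      (∀ a ∈ X, a ∉ Z \ Spec r Z T f Yp → CrAt r X g a) ∧ ∀ x ∈ X, dist (f x) (g x) < ε x := by
  have hS : DS L (Spec r Z T f Yp) := DS.spec hZ hf hY.part
  obtain ⟨D, hDd, hDc, hD01, hDpos, hD⟩ := exists_radius (L := L) (α := α)
    (A := fun p => ¬ (p.1 ∈ Z ∧ p.1 ∉ Spec r Z T f Yp)) (by fun_prop)
  have hCc : ∀ a ∈ X, a ∉ Z \ Spec r Z T f Yp → 0 < D a := by
    intro a ha haC
    refine hDpos a ?_
    have : ∀ᶠ z in 𝓝 a, ¬ (z ∈ Z ∧ z ∉ Spec r Z T f Yp) := by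
      by_cases haZ : a ∈ Z
      · have haS : a ∈ Spec r Z T f Yp := by
          by_contra h
          exact haC ⟨haZ, h⟩
        exact (Spec.eventually haS).mono fun w hw h => h.2 (hw h.1)
      · exact (hZc a ha haZ).mono fun w hw h => hw h.1
    exact (continuous_fst.tendsto (a, a)).eventually this
  have hD0 : ∀ a ∈ Z \ Spec r Z T f Yp, D a = 0 := by
    intro a ha
    by_contra h
    have hpos : 0 < D a := lt_of_le_of_ne (hD01 a).1 (Ne.symm h)
    exact hD a a a (by rwa [dist_self]) (by rwa [dist_self]) ha
  obtain ⟨R, hRd, hRc, hR0, hR1, hRpos, hRcl, hRinj, hRG⟩ := exists_step_radius (T := T)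
    (η := fun w => min (ε w) (D w)) hY hX hZ hZX hf hfc hfY
    (by fun_prop) (ContinuousOn.inf hεc hDc.continuousOn) fun s hs => lt_min (hε0 s (hZX (Spec.subset hs)))
      (hCc s (hZX (Spec.subset hs)) fun h => h.2 hs)
  obtain ⟨δ, hδd, hδ⟩ := hδ R hRd hRc hRpos
  obtain ⟨N, π, φ, hN⟩ := exists_tube (T := T) hS
    (fun s hs => ⟨_, (Spec.locGraph hs).choose_spec.1⟩) hRc
    hR0 hR1 hRcl hRinj hδd (fun s hs => (hδ s hs).1) (fun s hs => (hδ s hs).2.1)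
    (fun s hs => (hδ s hs).2.2)
  classical
  let g : (α → ℝ) → β → ℝ := fun z => if z ∈ N then G (f (π z), f z, φ z) else f z
  have hkey : ∀ z ∈ X, z ∈ N → ∀ t : ℝ, 0 ≤ t → t ≤ 1 → (f (π z), f z, t) ∈ Ω ∧
      dist (G (f (π z), f z, t)) (f z) < min (ε z) (D z) := fun z hzX hzN =>
    hRG (π z) z (hN.proj_mem z hzN) hzX (hN.dist_lt z hzN)
  have hclose : ∀ z ∈ X, dist (f z) (g z) ≤ D z ∧ dist (f z) (g z) < ε z := by
    intro z hz
    by_cases hzN : z ∈ N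
    · have := (hkey z hz hzN (φ z) (hN.cut_nonneg z) (hN.cut_le_one z)).2
      simp only [g, hzN, if_true]
      rw [dist_comm]
      exact ⟨this.le.trans (min_le_right _ _), this.trans_le (min_le_left _ _)⟩
    · simp only [g, hzN, if_false, dist_self]
      exact ⟨(hD01 z).1, hε0 z hz⟩
  have hproj : ∀ a ∈ N, ∃ k : (α → ℝ) → β → ℝ, ContDiffAt ℝ r k a ∧ k a = f (π a) ∧
      ∀ᶠ z in 𝓝 a, z ∈ N ∧ f (π z) = k z ∧ ∀ i, f (π a) ∈ Yp i → f (π z) ∈ Yp i := by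
    intro a ha
    have hmem := hN.proj_mem a ha
    obtain ⟨H, hH, hfH⟩ := Spec.locGraph hmem
    have hres := hN.res_eq a ha
    have ht : Filter.Tendsto (res T) (𝓝 a) (𝓝 (res T (π a))) :=
      hres ▸ (continuous_res T).continuousAt
    refine ⟨fun z => f (H (res T z)), ContDiffAt.comp (g := fun x => f (H x)) a
      (hres ▸ hfH) (contDiff_res T r).contDiffAt, congrArg f (by rw [← hres, hH.base]), ?_⟩
    filter_upwards [hN.proj_eq a ha H hH, ht.eventually hH.eventually_mem,
      ht.eventually (hH.tendsto.eventually (Filter.eventually_all.2 hmem.2))] with z h1 h2 h3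
    rw [h1.2]
    exact ⟨h1.1, rfl, fun i hi => (h3 i (Spec.subset h2)).2 hi⟩
  have hsmooth : ∀ a ∈ X, a ∉ Z \ Spec r Z T f Yp → CrAt r X g a := by
    intro a ha haC
    by_cases haN : a ∈ N
    · obtain ⟨k, hk, hka, hev⟩ := hproj a haN
      by_cases haS : a ∈ Spec r Z T f Yp
      · refine (CrAt.of_contDiffAt hk).congr ?_
        have h1 := hev.filter_mono (nhdsWithin_le_nhds (s := X))
        have h2 := (hN.cut_one a haS).filter_mono (nhdsWithin_le_nhds (s := X))
        filter_upwards [h1, h2, self_mem_nhdsWithin] with z h1 h2 hz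
        simp only [g, h1.1, if_true, h2]
        rw [hY.one _ _ (hkey z hz h1.1 1 zero_le_one le_rfl).1, h1.2.1]
      · have haZ : a ∉ Z := fun h => haC ⟨h, haS⟩
        obtain ⟨i, hi⟩ := hY.cover (f (π a)) (hfY (hZX (Spec.subset (hN.proj_mem a haN))))
        obtain ⟨K, hK, hKG⟩ := hY.smooth i (f (π a), f a, φ a)
          (hkey a ha haN _ (hN.cut_nonneg a) (hN.cut_le_one a)).1 hi
        have hp : CrAt r X (fun z => (f (π z), f z, φ z)) a :=
          ((CrAt.of_contDiffAt hk).congr ((hev.filter_mono nhdsWithin_le_nhds).mono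
            fun z hz => hz.2.1)).prodMk
            ((hfs a ha haZ).prodMk (CrAt.of_contDiffAt (hN.smooth a haN)))
        refine (hp.comp_contDiffAt ha hK).congr ?_
        filter_upwards [hev.filter_mono nhdsWithin_le_nhds,
          (hp.continuousWithinAt ha).tendsto.eventually hKG] with z h1 h2
        simp only [g, h1.1, if_true]
        exact h2 (h1.2.2 i hi)
    · have haS : a ∉ Spec r Z T f Yp := fun h => haN (hN.subset h)
      have haZ : a ∉ Z := fun h => haC ⟨h, haS⟩
      refine (hfs a ha haZ).congr ?_
      have hcl : a ∉ closure (Spec r Z T f Yp) := fun h => by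
        obtain ⟨z, hz, hz'⟩ := ((mem_closure_iff_frequently.1 h).and_eventually
          (hZc a ha haZ)).exists
        exact hz' (Spec.subset hz)
      filter_upwards [(hN.cut_zero a haN hcl).filter_mono nhdsWithin_le_nhds, self_mem_nhdsWithin]
        with z h1 hz
      by_cases hzN : z ∈ N
      · simp only [g, hzN, if_true, h1 hzN]
        exact hY.zero _ _ (hkey z hz hzN 0 le_rfl zero_le_one).1
      · simp only [g, hzN, if_false]
  refine ⟨g, ?_, ?_, ?_, hsmooth, fun x hx => (hclose x hx).2⟩
  · have h1 := hN.dom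
    have h2 := hN.proj
    have h3 := hN.cut
    have h4 := hY.map
    exact DF.ite (by fun_prop) (by fun_prop) hf
  · intro a ha
    by_cases haC : a ∈ Z \ Spec r Z T f Yp
    · have h0 := hD0 a haC
      have hga : g a = f a := by
        have := (hclose a ha).1
        rw [h0] at this
        exact (dist_le_zero.1 this).symm
      rw [ContinuousWithinAt, hga]
      refine (hfc a ha).congr_dist ?_
      refine squeeze_zero' (Filter.Eventually.of_forall fun _ => dist_nonneg)
        (self_mem_nhdsWithin (s := X) |> Filter.mem_of_superset <| fun z hz => (hclose z hz).1) ?_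
      rw [← h0]
      exact hDc.continuousWithinAt
    · exact (hsmooth a ha haC).continuousWithinAt ha
  · intro z hz
    by_cases hzN : z ∈ N
    · simp only [g, hzN, if_true]
      exact hY.mem _ (hkey z hz hzN _ (hN.cut_nonneg z) (hN.cut_le_one z)).1
    · simp only [g, hzN, if_false]
      exact hfY hz

end Smoothing

/-! ### Smoothing by induction on the strata -/

section Induction

variable {α : Type} [Fintype α]

theorem locallyGraph_univ (r : ℕ) : LocallyGraph r (univ : Set (α → ℝ)) := by
  refine fun y _ => ⟨Finset.univ, fun x i => x ⟨i, Finset.mem_univ i⟩, ?_, rfl,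
    Filter.Eventually.of_forall fun x => rfl, Filter.Eventually.of_forall fun w => ?_⟩
  · exact contDiffAt_pi.2 fun i =>
      (contDiff_apply ℝ ℝ (⟨i, Finset.mem_univ i⟩ : (Finset.univ : Finset α))).contDiffAt
  · exact iff_of_true (mem_univ w) rfl

open Classical in
/-- The sets of coordinates on which the projection of `Z` has nonempty interior. -/
noncomputable def bigSets (Z : Set (α → ℝ)) : Finset (Finset α) := Finset.univ.filter (Big Z)

theorem mem_bigSets {Z : Set (α → ℝ)} {T : Finset α} : T ∈ bigSets Z ↔ Big Z T := by
  simp [bigSets]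

theorem card_bigSets_lt {Z Z' : Set (α → ℝ)} {T : Finset α} (hZ : Z' ⊆ Z) (h : Big Z T)
    (h' : ¬ Big Z' T) : (bigSets Z').card < (bigSets Z).card := by
  refine Finset.card_lt_card (Finset.ssubset_iff_of_subset ?_ |>.2
    ⟨T, mem_bigSets.2 h, fun hT => h' (mem_bigSets.1 hT)⟩)
  exact fun T' hT' => mem_bigSets.2 ((mem_bigSets.1 hT').mono hZ)

theorem Spec.eventually_notMem_diff {β κ : Type} [Fintype β] [Finite κ] {r : ℕ}
    {Z : Set (α → ℝ)} {T : Finset α} {f : (α → ℝ) → β → ℝ} {Yp : κ → Set (β → ℝ)} {s : α → ℝ}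
    (hs : s ∈ Spec r Z T f Yp) : ∀ᶠ w in 𝓝 s, w ∉ Z \ Spec r Z T f Yp :=
  (Spec.eventually hs).mono fun _ hw h => h.2 (hw h.1)

/-- A continuous definable map which is `C^r` off a relatively closed set `Z` can be approximated
by definable `C^r` maps. -/
theorem exists_smoothing [OMin L] (r k : ℕ) : ∀ (β : Type) [Fintype β] (Y : Set (β → ℝ))
    (X Z : Set (α → ℝ)) (f : (α → ℝ) → β → ℝ) (ε : (α → ℝ) → ℝ), DS L Y → LocallyGraph r Y →
    DS L X → DS L Z → Z ⊆ X → (∀ a ∈ X, a ∉ Z → ∀ᶠ z in 𝓝 a, z ∉ Z) → DF L f →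
    ContinuousOn f X → MapsTo f X Y → (∀ a ∈ X, a ∉ Z → CrAt r X f a) → DF L ε →
    ContinuousOn ε X → (∀ x ∈ X, 0 < ε x) → (bigSets Z).card < k →
    ∃ g : (α → ℝ) → β → ℝ, DF L g ∧ MapsTo g X Y ∧ (∀ a ∈ X, CrAt r X g a) ∧
      ∀ x ∈ X, dist (f x) (g x) < ε x := by
  classical
  induction k with
  | zero => intros; omega
  | succ k ih =>
    intro β _ Y X Z f ε hY hYg hX hZ hZX hZc hf hfc hfY hfs hε hεc hε0 hk
    rcases Z.eq_empty_or_nonempty with rfl | hne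
    · exact ⟨f, hf, hfY, fun a ha => hfs a ha (notMem_empty a), fun x hx => by
        simpa using hε0 x hx⟩
    obtain ⟨T, hT, hmax⟩ := Finset.exists_max_image (bigSets Z) Finset.card
      ⟨∅, mem_bigSets.2 (big_empty hne)⟩
    have hT' : ∀ j ∉ T, ¬ Big Z (insert j T) := fun j hj h => by
      have := hmax _ (mem_bigSets.2 h)
      rw [Finset.card_insert_of_notMem hj] at this
      omega
    obtain ⟨Yp, Ω, G, hG⟩ := exists_interpolation hY hYg
    have hS : DS L (Spec r Z T f Yp) := DS.spec hZ hf hG.part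
    have hδ : ∀ R : (α → ℝ) → ℝ, DF L R → Continuous R → (∀ s ∈ Spec r Z T f Yp, 0 < R s) →
        ∃ δ : (α → ℝ) → ℝ, DF L δ ∧ ∀ s ∈ Spec r Z T f Yp,
          CrAt r (Spec r Z T f Yp) δ s ∧ 0 < δ s ∧ 2 * δ s < R s := by
      intro R hRd hRc hR0
      have hSZ : Spec r Z T f Yp ⊆ Z := Spec.subset
      generalize Spec r Z T f Yp = S at *
      let f' : (α → ℝ) → Unit → ℝ := fun z _ => R z / 4
      let S' : Set (α → ℝ) := Spec r S T f' (fun _ : Empty => (∅ : Set (Unit → ℝ)))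
      have hf'd : DF L f' := by fun_prop
      have hS' : DS L S' := DS.spec hS hf'd fun i => i.elim
      have hbig : ¬ Big (S \ S') T :=
        not_big_diff_spec r hS hf'd (fun i => i.elim) fun j hj h => hT' j hj (h.mono hSZ)
      have hcr : ∀ a ∈ S, a ∉ S \ S' → CrAt r S f' a := by
        intro a ha haS
        obtain ⟨⟨H, hH, hfH⟩, -⟩ : a ∈ S' := not_not.1 fun h => haS ⟨ha, h⟩
        refine ⟨fun z => f' (H (res T z)), ContDiffAt.comp (g := fun x => f' (H x)) a hfH
          (contDiff_res T r).contDiffAt, ?_⟩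
        rw [eventually_nhdsWithin_iff]
        exact hH.mem.mono fun w hw hwS => congrArg f' (hw.1 hwS).symm
      obtain ⟨g, hgd, -, hgs, hg⟩ := ih Unit univ S (S \ S') f' (fun z => R z / 8)
        (DP.const True) (locallyGraph_univ r) hS (DP.and hS hS'.not) sdiff_subset
        (fun a ha haS => Spec.eventually_notMem_diff (not_not.1 fun h => haS ⟨ha, h⟩)) hf'd
        (by fun_prop) (mapsTo_univ _ _) hcr (by fun_prop) (by fun_prop)
        (fun s hs => by linarith [hR0 s hs])
        (by
          have := card_bigSets_lt (sdiff_subset.trans hSZ) (mem_bigSets.1 hT) hbig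
          omega)
      refine ⟨fun z => g z (), DF.comp (DF.apply ()) hgd, fun s hs => ⟨?_, ?_⟩⟩
      · exact (hgs s hs).comp_contDiffAt hs (contDiff_apply ℝ ℝ ()).contDiffAt
      · have h1 := (dist_le_pi_dist (f' s) (g s) ()).trans_lt (hg s hs)
        rw [Real.dist_eq, abs_lt] at h1
        have h2 : f' s () = R s / 4 := rfl
        have h3 := hR0 s hs
        constructor <;> linarith
    obtain ⟨g₁, h1, h2, h3, h4, h5⟩ := exists_smoothing_step hG hX hZ hZX hZc hf hfc hfY hfs
      (ε := fun x => ε x / 2) (by fun_prop) (by fun_prop) (fun x hx => half_pos (hε0 x hx)) hδ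
    obtain ⟨g, g1, g2, g3, g4⟩ := ih β Y X (Z \ Spec r Z T f Yp) g₁ (fun x => ε x / 2) hY hYg hX
      (DP.and hZ hS.not) (sdiff_subset.trans hZX) (by
        intro a ha haZ
        by_cases haZ' : a ∈ Z
        · exact Spec.eventually_notMem_diff (not_not.1 fun h => haZ ⟨haZ', h⟩)
        · exact (hZc a ha haZ').mono fun z hz h => hz h.1) h1 h2 h3 h4
      (by fun_prop) (by fun_prop) (fun x hx => half_pos (hε0 x hx))
      (by
        have := card_bigSets_lt sdiff_subset (mem_bigSets.1 hT)
          (not_big_diff_spec r hZ hf hG.part hT')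
        omega)
    refine ⟨g, g1, g2, g3, fun x hx => ?_⟩
    linarith [dist_triangle (f x) (g₁ x) (g x), h5 x hx, g4 x hx]

end Induction

/-! ### Submanifolds are locally graphs -/

section Chart

variable {α : Type} [Fintype α]

theorem exists_coordinate_equiv {E : Type} [NormedAddCommGroup E] [NormedSpace ℝ E]
    [FiniteDimensional ℝ E] {A : E →L[ℝ] α → ℝ} (hA : ∀ u, A u = 0 → u = 0) :
    ∃ (T : Finset α) (e : E ≃L[ℝ] T → ℝ), ∀ u, e u = res T (A u) := by
  classical
  obtain ⟨T, hT⟩ := exists_minimal_of_wellFoundedLT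
    (fun T : Finset α => ∀ u, (∀ i ∈ T, A u i = 0) → u = 0)
    ⟨Finset.univ, fun u hu => hA u (funext fun i => hu i (Finset.mem_univ i))⟩
  let B : E →ₗ[ℝ] T → ℝ := (LinearMap.funLeft ℝ ℝ (Subtype.val : T → α)).comp A.toLinearMap
  have hB : ∀ u, B u = res T (A u) := fun _ => rfl
  have hinj : Function.Injective B := by
    rw [injective_iff_map_eq_zero]
    exact fun u hu => hT.prop u fun i hi => congrFun hu ⟨i, hi⟩
  have hsurj : Function.Surjective B := by
    rw [← LinearMap.range_eq_top]
    by_contra h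
    obtain ⟨c, hc0, hc⟩ := Submodule.exists_le_ker_of_lt_top _ (lt_top_iff_ne_top.2 h)
    obtain ⟨j, hj⟩ : ∃ j, c (Pi.single j 1) ≠ 0 := by
      by_contra! hall
      exact hc0 (LinearMap.pi_ext' fun j => LinearMap.ext_ring (by simpa using hall j))
    refine (Finset.erase_ssubset j.2).not_ge (hT.le_of_le (fun u hu => hT.prop u ?_)
      (Finset.erase_subset _ _))
    have hu' : B u = A u j • Pi.single j 1 := by
      ext i
      by_cases hij : i = j
      · subst hij
        simp [hB, res]
      · have := hu i (Finset.mem_erase.2 ⟨fun h => hij (Subtype.ext h), i.2⟩)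
        simp [hB, res, this, hij]
    have hcu : c (B u) = 0 := hc ⟨u, rfl⟩
    rw [hu', map_smul, smul_eq_mul, mul_eq_zero, or_iff_left hj] at hcu
    intro i hi
    by_cases hij : i = j
    · rw [hij, hcu]
    · exact hu i (Finset.mem_erase.2 ⟨hij, hi⟩)
  exact ⟨T, (LinearEquiv.ofBijective B ⟨hinj, hsurj⟩).toContinuousLinearEquiv, fun _ => rfl⟩

/-- A set with a local parametrization that has a differentiable left inverse is a graph. -/
theorem exists_locGraph_of_parametrization {E : Type} [NormedAddCommGroup E] [NormedSpace ℝ E]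
    [FiniteDimensional ℝ E] {r : ℕ} (hr : r ≠ 0) {Y : Set (α → ℝ)} {γ : E → α → ℝ}
    {κ : (α → ℝ) → E} (hγ : ContDiffAt ℝ r γ 0) (hκ : DifferentiableAt ℝ κ (γ 0))
    (hκγ : ∀ᶠ u in 𝓝 0, κ (γ u) = u) (hγκ : ∀ᶠ w in 𝓝 (γ 0), w ∈ Y → γ (κ w) = w)
    (hγY : ∀ᶠ u in 𝓝 0, γ u ∈ Y) : ∃ T H, LocGraph r Y T (γ 0) H := by
  have hr' : (r : WithTop ℕ∞) ≠ 0 := by exact_mod_cast hr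
  have hγd := hγ.differentiableAt hr'
  have hid : (fderiv ℝ κ (γ 0)).comp (fderiv ℝ γ 0) = ContinuousLinearMap.id ℝ E := by
    rw [← fderiv_comp _ hκ hγd, ← fderiv_id (𝕜 := ℝ) (x := (0 : E))]
    exact Filter.EventuallyEq.fderiv_eq hκγ
  obtain ⟨T, e, he⟩ := exists_coordinate_equiv (A := fderiv ℝ γ 0) fun u hu => by
    have := DFunLike.congr_fun hid u
    simpa [hu] using this.symm
  have hΓ : ContDiffAt ℝ r (fun u => res T (γ u)) 0 :=
    (contDiff_res T r).contDiffAt.comp 0 hγ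
  have hΓ' : HasFDerivAt (fun u => res T (γ u)) (e : E →L[ℝ] T → ℝ) 0 := by
    rw [hasFDerivAt_pi']
    intro i
    refine HasFDerivAt.congr_fderiv (hasFDerivAt_pi'.1 hγd.hasFDerivAt (i : α)) ?_
    ext u
    exact (congrFun (he u) i).symm
  let Δ := hΓ.localInverse hΓ' hr'
  have hs := hΓ.hasStrictFDerivAt' hΓ' hr'
  have hΔ0 : Δ (res T (γ 0)) = 0 := hΓ.localInverse_apply_image hΓ' hr'
  have hΔ : ContDiffAt ℝ r Δ (res T (γ 0)) := hΓ.to_localInverse hΓ' hr'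
  have hleft : ∀ᶠ u in 𝓝 (0 : E), Δ (res T (γ u)) = u := hs.eventually_left_inverse
  have hright : ∀ᶠ x in 𝓝 (res T (γ 0)), res T (γ (Δ x)) = x := hs.eventually_right_inverse
  have hΔt : Filter.Tendsto (fun w => Δ (res T w)) (𝓝 (γ 0)) (𝓝 0) := by
    have := (hΔ.continuousAt.comp (continuous_res T).continuousAt : ContinuousAt
      (fun w => Δ (res T w)) (γ 0)).tendsto
    rwa [Function.comp_apply, hΔ0] at this
  have hκt : Filter.Tendsto κ (𝓝 (γ 0)) (𝓝 0) := by
    have := hκ.continuousAt.tendsto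
    rwa [hκγ.self_of_nhds] at this
  refine ⟨T, fun x => γ (Δ x), ?_, congrArg γ hΔ0, hright, ?_⟩
  · exact ContDiffAt.comp _ (by rwa [hΔ0]) hΔ
  · filter_upwards [hγκ, hΔt.eventually hγY, hκt.eventually hleft] with w h1 h2 h3
    refine ⟨fun hw => ?_, fun hw => hw ▸ h2⟩
    rw [h1 hw] at h3
    simp only [h3, h1 hw]

theorem IsDefCrSubmanifold.locallyGraph {r n d : ℕ} (hr : r ≠ 0) {Y : Set (Fin n → ℝ)}
    (h : IsDefCrSubmanifold L r n d Y) : LocallyGraph r Y := by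
  intro a ha
  obtain ⟨U, V, φ, ψ, haU, hU, -, hV0, hV, -, -, -, hφ, hψ, hbij, hinv, hφa, himg⟩ := h.2 a ha
  let D := {i : Fin n // (i : ℕ) < d}
  let e : (D → ℝ) → Fin n → ℝ := fun u i => if hi : (i : ℕ) < d then u ⟨i, hi⟩ else 0
  let κ : (Fin n → ℝ) → D → ℝ := fun w i => φ w i
  have he : ContDiff ℝ r e := by
    refine contDiff_pi.2 fun i => ?_
    by_cases hi : (i : ℕ) < d
    · simp only [e, hi, dite_true]
      exact contDiff_apply ℝ ℝ _
    · simp only [e, hi, dite_false]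
      exact contDiff_const
  have he0 : e 0 = 0 := by
    ext i
    simp [e]
  have hez : ∀ u (i : Fin n), d ≤ (i : ℕ) → e u i = 0 := fun u i hi => dif_neg hi.not_gt
  have hed : ∀ u (i : D), e u i = u i := fun u i => dif_pos i.2
  have hψ0 : ψ 0 = a := by rw [← hφa, hinv.1 haU]
  have heV : ∀ᶠ u in 𝓝 (0 : D → ℝ), e u ∈ V :=
    he.continuous.continuousAt.eventually (by rw [he0]; exact hV.mem_nhds hV0)
  have hγ0 : ψ (e 0) = a := by rw [he0, hψ0]
  have key := exists_locGraph_of_parametrization (Y := Y) (γ := fun u => ψ (e u)) (κ := κ) hr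
    (ContDiffAt.comp (g := ψ) 0 (by rw [he0]; exact hψ.contDiffAt (hV.mem_nhds hV0))
      he.contDiffAt) ?_ ?_ ?_ ?_
  · rwa [hγ0] at key
  · rw [hγ0, differentiableAt_pi]
    intro i
    have := (hφ.contDiffAt (hU.mem_nhds haU)).differentiableAt (n := r) (by exact_mod_cast hr)
    exact differentiableAt_pi.1 this i
  · filter_upwards [heV] with u hu
    ext i
    simp only [κ, hinv.2 hu, hed]
  · rw [hγ0]
    filter_upwards [hU.mem_nhds haU] with w hw hwY
    have hz : φ w ∈ {x ∈ V | ∀ i : Fin n, d ≤ (i : ℕ) → x i = 0} := himg ▸ ⟨w, ⟨hwY, hw⟩, rfl⟩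
    have : e (κ w) = φ w := by
      ext i
      by_cases hi : (i : ℕ) < d
      · exact hed (κ w) ⟨i, hi⟩
      · rw [hez _ _ (not_lt.1 hi), hz.2 i (not_lt.1 hi)]
    rw [this, hinv.1 hw]
  · filter_upwards [heV] with u hu
    obtain ⟨w, ⟨hwY, hwU⟩, hw⟩ : e u ∈ φ '' (Y ∩ U) := himg ▸ ⟨hu, hez u⟩
    rwa [← hw, hinv.1 hwU]

end Chart

/-! ### Conversion to definability on subsets -/

theorem eunorm_le {n : ℕ} (x : Fin n → ℝ) : eunorm x ≤ n * ‖x‖ := by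
  have h0 : 0 ≤ ∑ i, |x i| := Finset.sum_nonneg fun i _ => abs_nonneg _
  calc eunorm x ≤ ∑ i, |x i| := by
        refine Real.sqrt_le_iff.2 ⟨h0, ?_⟩
        simpa using Finset.sum_sq_le_sq_sum_of_nonneg (s := Finset.univ)
          (fun i (_ : i ∈ Finset.univ) => abs_nonneg (x i))
    _ ≤ ∑ _i : Fin n, ‖x‖ := Finset.sum_le_sum fun i _ => norm_le_pi_norm x i
    _ = n * ‖x‖ := by simp

section Conversion

variable {m n : ℕ} {X : Set (Fin m → ℝ)} {f : (Fin m → ℝ) → Fin n → ℝ}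

@[fun_prop]
theorem DF.fstFun {E : Type} [TopologicalSpace E] [Coord E] {g : E → Fin (m + n) → ℝ}
    (hg : DF L g) : DF L (fun x => fstFun (g x)) :=
  DF.pi fun i => DF.comp (DF.apply (Fin.castAdd n i)) hg

@[fun_prop]
theorem DF.sndFun {E : Type} [TopologicalSpace E] [Coord E] {g : E → Fin (m + n) → ℝ}
    (hg : DF L g) : DF L (fun x => sndFun (g x)) :=
  DF.pi fun i => DF.comp (DF.apply (Fin.natAdd m i)) hg

theorem DF.append {E : Type} [TopologicalSpace E] [Coord E] {g : E → Fin m → ℝ}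
    {h : E → Fin n → ℝ} (hg : DF L g) (hh : DF L h) : DF L (fun x => Fin.append (g x) (h x)) := by
  refine DF.pi fun i => ?_
  induction i using Fin.addCases with
  | left i =>
    simp only [Fin.append_left]
    exact DF.comp (DF.apply i) hg
  | right i =>
    simp only [Fin.append_right]
    exact DF.comp (DF.apply i) hh

theorem DF.defMapOn (hX : DS L X) (hf : DF L f) : DefMapOn L m n X f := by
  have : DP L (fun z : Fin (m + n) → ℝ => Paper.fstFun z ∈ X ∧
    Paper.sndFun z = f (Paper.fstFun z)) := by fun_prop
  exact this

open Classical in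
theorem DefMapOn.extend (hX : DS L X) (hf : DefMapOn L m n X f) :
    DF L (fun x => if x ∈ X then f x else 0) := by
  have hf' : DS L {z : Fin (m + n) → ℝ | fstFun z ∈ X ∧ sndFun z = f (fstFun z)} := hf
  have h1 : DP L (fun p : (Fin m → ℝ) × (Fin n → ℝ) => p.1 ∈ X ∧ p.2 = f p.1) := by
    refine (DP.mem hf' (DF.append DF.fst DF.snd)).congr fun p => ?_
    have h1 : fstFun (Fin.append p.1 p.2) = p.1 := funext fun i => Fin.append_left _ _ i
    have h2 : sndFun (Fin.append p.1 p.2) = p.2 := funext fun i => Fin.append_right _ _ i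
    simp only [mem_ofPred_eq, h1, h2]
  have h2 : DP L (fun p : (Fin m → ℝ) × (Fin n → ℝ) => p.1 ∉ X ∧ p.2 = 0) :=
    DP.and (DP.mem hX DF.fst).not (DP.eq DF.snd (DF.const 0))
  refine (h1.or h2).congr fun p => ?_
  by_cases hp : p.1 ∈ X <;> simp [hp, eq_comm]

theorem CrMapOn.continuousOn {r : ℕ} (hf : CrMapOn r m n X f) : ContinuousOn f X := by
  intro a ha
  obtain ⟨W, g, haW, hW, hg, hfg⟩ := hf a ha
  have hgc := (hg.continuousOn.continuousAt (hW.mem_nhds haW)).continuousWithinAt (s := X)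
  refine hgc.congr_of_eventuallyEq ?_ (hfg ⟨ha, haW⟩)
  filter_upwards [self_mem_nhdsWithin, mem_nhdsWithin_of_mem_nhds (hW.mem_nhds haW)] with z h1 h2
    using hfg ⟨h1, h2⟩

theorem crMapOn_of_crAt {r : ℕ} (h : ∀ a ∈ X, CrAt r X f a) : CrMapOn r m n X f := by
  intro a ha
  obtain ⟨g, hg, hfg⟩ := h a ha
  rw [eventually_nhdsWithin_iff] at hfg
  obtain ⟨W, hW, hWo, haW⟩ := eventually_nhds_iff.1 ((hg.eventually (by simp)).and hfg)
  exact ⟨W, g, haW, hWo, fun x hx => (hW x hx).1.contDiffWithinAt,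
    fun x hx => (hW x hx.2).2 hx.1⟩

end Conversion

end Helpers

/-- a definable `C^{r-1}` map between definable `C^r` submanifolds admits a
definable `C^r` approximation. -/
theorem statement1
    (hfield : ExpandsOrderedField L) (hlom : LocallyOMinimal L)
    (r : ℕ) (hr : 1 ≤ r) (m n dX dY : ℕ)
    (X : Set (Fin m → ℝ)) (Y : Set (Fin n → ℝ))
    (hX : IsDefCrSubmanifold L r m dX X) (hY : IsDefCrSubmanifold L r n dY Y)
    (f : (Fin m → ℝ) → (Fin n → ℝ)) (hfmaps : Set.MapsTo f X Y)
    (hf : DefCrMapOn L (r - 1) m n X f)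
    (ε : (Fin m → ℝ) → ℝ) (hεdef : DefFunOn L m X ε)
    (hεpos : ∀ x ∈ X, 0 < ε x) (hεcont : ContinuousOn ε X) :
    ∃ ftil : (Fin m → ℝ) → (Fin n → ℝ), Set.MapsTo ftil X Y ∧
      DefCrMapOn L r m n X ftil ∧ ∀ x ∈ X, eunorm (f x - ftil x) < ε x := by
  classical
  have : OMin L := ⟨hfield, hlom⟩
  have hXd : DS L X := hX.1
  have hf' := hf.1.extend hXd
  have hε' := DF.comp (DF.apply (0 : Fin 1)) (DefMapOn.extend hXd hεdef)
  set f' : (Fin m → ℝ) → Fin n → ℝ := fun x => if x ∈ X then f x else 0 with hf'_def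
  let ε' : (Fin m → ℝ) → ℝ := fun x => (if x ∈ X then (fun _ : Fin 1 => ε x) else 0) 0 / (n + 1)
  have hff' : EqOn f' f X := fun x hx => if_pos hx
  have hεε' : EqOn ε' (fun x => ε x / (n + 1)) X := fun x hx => by simp [ε', hx]
  have hε'd : DF L ε' := DF.div hε' (DF.const _)
  obtain ⟨g, hg, hgY, hgs, hfg⟩ := exists_smoothing (L := L) r ((bigSets X).card + 1) (Fin n) Y X X
    f' ε' hY.1 (hY.locallyGraph (by omega)) hXd hXd subset_rfl (fun a ha h => absurd ha h) hf'
    (hf.2.continuousOn.congr hff') (hfmaps.congr hff'.symm) (fun a ha h => absurd ha h) hε'd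
    ((hεcont.div_const _).congr hεε')
    (fun x hx => by rw [hεε' hx]; exact div_pos (hεpos x hx) (by positivity)) (Nat.lt_succ_self _)
  refine ⟨g, hgY, ⟨hg.defMapOn hXd, crMapOn_of_crAt hgs⟩, fun x hx => ?_⟩
  have h1 := hfg x hx
  rw [hff' hx, hεε' hx, dist_eq_norm, lt_div_iff₀ (by positivity)] at h1
  nlinarith [eunorm_le (f x - g x), norm_nonneg (f x - g x)]

end Paper
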